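/- arXiv:1605.03792 — 4 statements merged into one kernel-verified Lean document; each statement's English description precedes it below -/
import Mathlib

section
/- Let p be a prime, n ≥ 1, and let (ℓ₀, ℓ₁, …, ℓₙ) be integers with ℓ₁ ≤ ℓ₂ ≤ ⋯ ≤ ℓₙ ≤ ℓ₀/2. Set λ(p) = diag(p^{ℓ₁}, …, p^{ℓₙ}, p^{ℓ₀−ℓ₁}, …, p^{ℓ₀−ℓₙ}) ∈ M_{2n}(ℚ_p). Let g ∈ M_{2n}(ℚ_p) satisfy ᵀg·J·g = r(g)·J for some nonzero r(g) ∈ ℚ_p. Then there exist k₁, k₂ ∈ GSp_{2n}(ℤ_p) with k₁·g·k₂ = λ(p) if and only if both of the following hold: (1) the p-adic norm of r(g) equals p^{−ℓ₀}; (2) for each m = 1, …, n, the maximum of the p-adic norms of the determinants of all m×m submatrices of g equals p^{−(ℓ₁+⋯+ℓₘ)}. -/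
open Matrix

/-- The standard symplectic form matrix `J = [[0, Iₙ],[−Iₙ, 0]]`. -/
def Jmat (n : ℕ) (R : Type*) [CommRing R] :
    Matrix (Fin n ⊕ Fin n) (Fin n ⊕ Fin n) R :=
  Matrix.fromBlocks 0 1 (-1) 0

/-- Membership in `GSp_{2n}(ℤ_p)`: an integral matrix whose similitude is a unit. -/
def IsGSpZp (p : ℕ) [Fact p.Prime] (n : ℕ)
    (k : Matrix (Fin n ⊕ Fin n) (Fin n ⊕ Fin n) ℤ_[p]) : Prop :=
  ∃ u : ℤ_[p]ˣ, kᵀ * Jmat n ℤ_[p] * k = (u : ℤ_[p]) • Jmat n ℤ_[p]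

section helpers
variable {p : ℕ} [Fact p.Prime] {n : ℕ}

theorem Jmat_sq (n : ℕ) (R : Type*) [CommRing R] : Jmat n R * Jmat n R = -1 := by
  simp [Jmat, Matrix.fromBlocks_multiply, ← Matrix.fromBlocks_one, Matrix.fromBlocks_neg]

theorem Jmat_transpose (n : ℕ) (R : Type*) [CommRing R] : (Jmat n R)ᵀ = -Jmat n R := by
  simp [Jmat, Matrix.fromBlocks_transpose, Matrix.fromBlocks_neg]

/-- Integral entries. -/
def IntM (k : Matrix (Fin n ⊕ Fin n) (Fin n ⊕ Fin n) ℚ_[p]) : Prop := ∀ i j, ‖k i j‖ ≤ 1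

/-- The image of `GSp(ℤ_p)` in `GSp(ℚ_p)`. -/
def KQ (k : Matrix (Fin n ⊕ Fin n) (Fin n ⊕ Fin n) ℚ_[p]) : Prop :=
  IntM k ∧ ∃ u : ℚ_[p], ‖u‖ = 1 ∧ kᵀ * Jmat n ℚ_[p] * k = u • Jmat n ℚ_[p]

theorem norm_sum_le' {ι : Type*} (s : Finset ι) (f : ι → ℚ_[p]) {c : ℝ} (hc : 0 ≤ c)
    (h : ∀ i ∈ s, ‖f i‖ ≤ c) : ‖∑ i ∈ s, f i‖ ≤ c :=
  IsUltrametricDist.norm_sum_le_of_forall_le_of_nonneg hc h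

theorem IntM.mul {a b : Matrix (Fin n ⊕ Fin n) (Fin n ⊕ Fin n) ℚ_[p]}
    (ha : IntM a) (hb : IntM b) : IntM (a * b) := by
  intro i j
  rw [Matrix.mul_apply]
  refine norm_sum_le' _ _ zero_le_one fun x _ => ?_
  rw [norm_mul]
  exact mul_le_one₀ (ha _ _) (norm_nonneg _) (hb _ _)

theorem intM_J : IntM (Jmat n ℚ_[p]) := by
  rintro (i | i) (j | j) <;> simp [Jmat, Matrix.one_apply] <;> split_ifs <;> simp

theorem sim_mul {R : Type*} [CommRing R] {a b : Matrix (Fin n ⊕ Fin n) (Fin n ⊕ Fin n) R} {u v : R}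
    (ha : aᵀ * Jmat n R * a = u • Jmat n R) (hb : bᵀ * Jmat n R * b = v • Jmat n R) :
    (a * b)ᵀ * Jmat n R * (a * b) = (u * v) • Jmat n R := by
  have : (a * b)ᵀ * Jmat n R * (a * b) = bᵀ * (aᵀ * Jmat n R * a) * b := by
    simp only [Matrix.transpose_mul, Matrix.mul_assoc]
  rw [this, ha, Matrix.mul_smul, Matrix.smul_mul, hb, smul_smul]

theorem KQ.mul {a b : Matrix (Fin n ⊕ Fin n) (Fin n ⊕ Fin n) ℚ_[p]}
    (ha : KQ a) (hb : KQ b) : KQ (a * b) := by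
  obtain ⟨ha, u, hu, hau⟩ := ha
  obtain ⟨hb, v, hv, hbv⟩ := hb
  exact ⟨ha.mul hb, u * v, by simp [hu, hv], sim_mul hau hbv⟩

theorem sim_inv {F : Type*} [Field F] {a : Matrix (Fin n ⊕ Fin n) (Fin n ⊕ Fin n) F} {u : F}
    (hu : u ≠ 0) (ha : aᵀ * Jmat n F * a = u • Jmat n F) :
    (-u⁻¹) • (Jmat n F * aᵀ * Jmat n F) * a = 1 := by
  have : Jmat n F * aᵀ * Jmat n F * a = Jmat n F * (aᵀ * Jmat n F * a) := by
    simp only [Matrix.mul_assoc]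
  rw [Matrix.smul_mul, this, ha, Matrix.mul_smul, Jmat_sq, smul_smul]
  simp [hu]

theorem sim_transpose {F : Type*} [Field F] {a : Matrix (Fin n ⊕ Fin n) (Fin n ⊕ Fin n) F} {u : F}
    (hu : u ≠ 0) (ha : aᵀ * Jmat n F * a = u • Jmat n F) :
    a * Jmat n F * aᵀ = u • Jmat n F := by
  have h := mul_eq_one_comm.1 (sim_inv hu ha)
  have h2 : a * Jmat n F * aᵀ * Jmat n F = (-u) • 1 := by
    rw [← h, Matrix.mul_smul, smul_smul]
    simp [hu, Matrix.mul_assoc]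
  have h3 := congrArg (· * (-Jmat n F)) h2
  simpa [Matrix.mul_assoc, Jmat_sq] using h3

theorem KQ.inv {a : Matrix (Fin n ⊕ Fin n) (Fin n ⊕ Fin n) ℚ_[p]} (ha : KQ a) :
    ∃ b, KQ b ∧ b * a = 1 ∧ a * b = 1 := by
  obtain ⟨ha, u, hu, hau⟩ := ha
  have hu0 : u ≠ 0 := by rintro rfl; simp at hu
  have h := sim_inv hu0 hau
  refine ⟨_, ⟨?_, u⁻¹, by simp [hu], ?_⟩, h, mul_eq_one_comm.1 h⟩
  · intro i j
    rw [Matrix.smul_apply, smul_eq_mul, norm_mul, norm_neg, norm_inv, hu, inv_one, one_mul]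
    exact (intM_J.mul (fun i j => ha j i) |>.mul intM_J) i j
  · have h' := mul_eq_one_comm.1 h
    set b := (-u⁻¹) • (Jmat n ℚ_[p] * aᵀ * Jmat n ℚ_[p]) with hb
    have e : bᵀ * (aᵀ * Jmat n ℚ_[p] * a) * b = Jmat n ℚ_[p] := by
      have : bᵀ * (aᵀ * Jmat n ℚ_[p] * a) * b = (a * b)ᵀ * Jmat n ℚ_[p] * (a * b) := by
        simp only [Matrix.transpose_mul, Matrix.mul_assoc]
      rw [this, h']; simp
    rw [hau, Matrix.mul_smul bᵀ, Matrix.smul_mul] at e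
    rw [← e, smul_smul, inv_mul_cancel₀ hu0, one_smul, e]

theorem kq_of_gsp {k : Matrix (Fin n ⊕ Fin n) (Fin n ⊕ Fin n) ℤ_[p]} (hk : IsGSpZp p n k) :
    KQ (k.map (fun a => (a : ℚ_[p]))) := by
  obtain ⟨u, hu⟩ := hk
  refine ⟨fun i j => (k i j).2, (u : ℤ_[p]), ?_, ?_⟩
  · exact PadicInt.norm_units u
  · have hJ : (Jmat n ℤ_[p]).map (PadicInt.Coe.ringHom (p := p)) = Jmat n ℚ_[p] := by
      simp [Jmat, Matrix.fromBlocks_map, Matrix.map_neg]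
    have := congrArg (fun M => M.map (PadicInt.Coe.ringHom (p := p))) hu
    simp only [Matrix.map_mul, hJ] at this
    change (k.map (PadicInt.Coe.ringHom (p := p)))ᵀ * _ * (k.map (PadicInt.Coe.ringHom (p := p))) = _
    rw [Matrix.transpose_map] at this
    rw [this, Matrix.map_smul' _ _ _ (map_mul _), hJ]
    rfl

theorem gsp_of_kq {k : Matrix (Fin n ⊕ Fin n) (Fin n ⊕ Fin n) ℚ_[p]} (hk : KQ k) :
    ∃ k' : Matrix (Fin n ⊕ Fin n) (Fin n ⊕ Fin n) ℤ_[p], IsGSpZp p n k' ∧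
      k'.map (fun a => (a : ℚ_[p])) = k := by
  obtain ⟨hi, u, hu, hk⟩ := hk
  let k' : Matrix (Fin n ⊕ Fin n) (Fin n ⊕ Fin n) ℤ_[p] := fun i j => ⟨k i j, hi i j⟩
  have hk' : k'.map (PadicInt.Coe.ringHom (p := p)) = k := rfl
  refine ⟨k', ⟨PadicInt.mkUnits hu, ?_⟩, hk'⟩
  have hJ : (Jmat n ℤ_[p]).map (PadicInt.Coe.ringHom (p := p)) = Jmat n ℚ_[p] := by
    simp [Jmat, Matrix.fromBlocks_map, Matrix.map_neg]
  have hinj : Function.Injective (PadicInt.Coe.ringHom (p := p)) := Subtype.val_injective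
  apply Matrix.map_injective hinj
  change (k'ᵀ * Jmat n ℤ_[p] * k').map (PadicInt.Coe.ringHom (p := p)) = (_ : Matrix _ _ _).map (PadicInt.Coe.ringHom (p := p))
  rw [Matrix.map_smul' _ _ _ (map_mul _), Matrix.map_mul, Matrix.map_mul, hJ, Matrix.transpose_map, hk', hk]
  rfl

/-- All `m × m` minors are bounded by `c`. -/
def MB (m : ℕ) (A : Matrix (Fin n ⊕ Fin n) (Fin n ⊕ Fin n) ℚ_[p]) (c : ℝ) : Prop :=
  ∀ ρ κ : Fin m → Fin n ⊕ Fin n, ‖(A.submatrix ρ κ).det‖ ≤ c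

theorem MB.mul_left {m : ℕ} {A k : Matrix (Fin n ⊕ Fin n) (Fin n ⊕ Fin n) ℚ_[p]} {c : ℝ}
    (hk : IntM k) (h : MB m A c) : MB m (k * A) c := by
  intro ρ κ
  have hc : 0 ≤ c := (norm_nonneg _).trans (h ρ κ)
  have e : ((k * A).submatrix ρ κ).det =
      ∑ f : Fin m → Fin n ⊕ Fin n, (∏ i, k (ρ i) (f i)) * (A.submatrix f κ).det := by
    have e1 : (k * A).submatrix ρ κ =
        fun i => ∑ j : Fin n ⊕ Fin n, k (ρ i) j • (fun t => A j (κ t)) := by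
      ext i t
      simp [Matrix.mul_apply, Finset.sum_apply]
    rw [e1]
    change Matrix.detRowAlternating.toMultilinearMap _ = _
    rw [MultilinearMap.map_sum]
    refine Finset.sum_congr rfl fun f _ => ?_
    rw [MultilinearMap.map_smul_univ]
    rfl
  rw [e]
  refine norm_sum_le' _ _ hc fun f _ => ?_
  rw [norm_mul, norm_prod]
  refine (mul_le_of_le_one_left (norm_nonneg _) ?_).trans (h f κ)
  exact Finset.prod_le_one (fun _ _ => norm_nonneg _) fun i _ => hk _ _

theorem MB.transpose {m : ℕ} {A : Matrix (Fin n ⊕ Fin n) (Fin n ⊕ Fin n) ℚ_[p]} {c : ℝ}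
    (h : MB m A c) : MB m Aᵀ c := by
  intro ρ κ
  rw [← Matrix.det_transpose]
  exact h κ ρ

theorem MB.mul_right {m : ℕ} {A k : Matrix (Fin n ⊕ Fin n) (Fin n ⊕ Fin n) ℚ_[p]} {c : ℝ}
    (hk : IntM k) (h : MB m A c) : MB m (A * k) c := by
  have := (h.transpose.mul_left (k := kᵀ) fun i j => hk j i).transpose
  rwa [Matrix.transpose_mul, Matrix.transpose_transpose, Matrix.transpose_transpose] at this

/-- The set of norms of minors. -/
def minorSet (m : ℕ) (A : Matrix (Fin n ⊕ Fin n) (Fin n ⊕ Fin n) ℚ_[p]) : Set ℝ :=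
  {s : ℝ | ∃ ρ κ : Fin m → Fin n ⊕ Fin n,
    Function.Injective ρ ∧ Function.Injective κ ∧ s = ‖(A.submatrix ρ κ).det‖}

theorem det_inj {m : ℕ} {A : Matrix (Fin n ⊕ Fin n) (Fin n ⊕ Fin n) ℚ_[p]}
    {ρ κ : Fin m → Fin n ⊕ Fin n} (h : (A.submatrix ρ κ).det ≠ 0) :
    Function.Injective ρ ∧ Function.Injective κ := by
  constructor
  · intro i j hij
    by_contra hne
    exact h (Matrix.det_zero_of_row_eq hne (by ext t; simp [hij]))
  · intro i j hij
    by_contra hne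
    exact h (Matrix.det_zero_of_column_eq hne (by intro t; simp [hij]))

theorem greatest_iff (hn : 1 ≤ n) {m : ℕ} {A : Matrix (Fin n ⊕ Fin n) (Fin n ⊕ Fin n) ℚ_[p]} {c : ℝ}
    (hc : 0 < c) : IsGreatest (minorSet m A) c ↔ ∀ c', 0 ≤ c' → (MB m A c' ↔ c ≤ c') := by
  constructor
  · rintro ⟨⟨ρ, κ, _, _, hs⟩, hub⟩ c' hc'
    constructor
    · intro h
      rw [hs]; exact h ρ κ
    · intro h ρ' κ'
      by_cases h0 : (A.submatrix ρ' κ').det = 0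
      · rw [h0, norm_zero]; exact hc'
      · exact (hub ⟨ρ', κ', (det_inj h0).1, (det_inj h0).2, rfl⟩).trans h
  · intro h
    have : Nonempty (Fin n ⊕ Fin n) := ⟨Sum.inl ⟨0, hn⟩⟩
    have hb : MB m A c := (h c hc.le).2 le_rfl
    obtain ⟨⟨ρ, κ⟩, hmax⟩ := Finite.exists_max
      (fun q : (Fin m → Fin n ⊕ Fin n) × (Fin m → Fin n ⊕ Fin n) => ‖(A.submatrix q.1 q.2).det‖)
    have h1 : c ≤ ‖(A.submatrix ρ κ).det‖ :=
      (h _ (norm_nonneg _)).1 fun ρ' κ' => hmax (ρ', κ')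
    have h0 : (A.submatrix ρ κ).det ≠ 0 := by
      intro h0; rw [h0, norm_zero] at h1; linarith
    refine ⟨⟨ρ, κ, (det_inj h0).1, (det_inj h0).2, le_antisymm h1 (hb _ _)⟩, ?_⟩
    rintro s ⟨ρ', κ', _, _, rfl⟩
    exact hb _ _

theorem greatest_equiv (hn : 1 ≤ n) {m : ℕ} {A B k₁ k₂ : Matrix (Fin n ⊕ Fin n) (Fin n ⊕ Fin n) ℚ_[p]}
    {c : ℝ} (hc : 0 < c) (h₁ : KQ k₁) (h₂ : KQ k₂) (h : k₁ * A * k₂ = B) :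
    IsGreatest (minorSet m A) c ↔ IsGreatest (minorSet m B) c := by
  rw [greatest_iff hn hc, greatest_iff hn hc]
  have : ∀ c', MB m A c' ↔ MB m B c' := by
    intro c'
    constructor
    · intro hA
      rw [← h]
      exact (hA.mul_left h₁.1).mul_right h₂.1
    · intro hB
      obtain ⟨b₁, hb₁, e₁, _⟩ := h₁.inv
      obtain ⟨b₂, hb₂, _, e₂⟩ := h₂.inv
      have : A = b₁ * B * b₂ := by
        rw [← h]
        calc A = (b₁ * k₁) * A * (k₂ * b₂) := by rw [e₁, e₂]; simp
          _ = _ := by simp only [Matrix.mul_assoc]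
      rw [this]
      exact (hB.mul_left hb₁.1).mul_right hb₂.1
  simp only [this]

/-- The symplectic form. -/
def om {F : Type*} [CommRing F] (z t : Fin n ⊕ Fin n → F) : F := z ⬝ᵥ (Jmat n F *ᵥ t)

theorem om_eq {F : Type*} [CommRing F] (z t : Fin n ⊕ Fin n → F) :
    om z t = ∑ i, (z (Sum.inl i) * t (Sum.inr i) - z (Sum.inr i) * t (Sum.inl i)) := by
  simp [om, Jmat, dotProduct, Matrix.mulVec, Fintype.sum_sum_type, Matrix.one_apply,
    Finset.sum_sub_distrib, sub_eq_add_neg, Finset.sum_add_distrib]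

theorem om_add_left {F : Type*} [CommRing F] (a b c : Fin n ⊕ Fin n → F) :
    om (a + b) c = om a c + om b c := by simp [om, add_dotProduct]
theorem om_add_right {F : Type*} [CommRing F] (a b c : Fin n ⊕ Fin n → F) :
    om a (b + c) = om a b + om a c := by simp [om, Matrix.mulVec_add, dotProduct_add]
theorem om_smul_left {F : Type*} [CommRing F] (x : F) (a b : Fin n ⊕ Fin n → F) :
    om (x • a) b = x * om a b := by simp [om, smul_dotProduct]
theorem om_smul_right {F : Type*} [CommRing F] (x : F) (a b : Fin n ⊕ Fin n → F) :
    om a (x • b) = x * om a b := by simp [om, Matrix.mulVec_smul, dotProduct_smul]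
theorem om_swap {F : Type*} [CommRing F] (a b : Fin n ⊕ Fin n → F) :
    om a b = - om b a := by
  rw [om_eq, om_eq, ← Finset.sum_neg_distrib]
  exact Finset.sum_congr rfl fun i _ => by ring
theorem om_self {F : Type*} [CommRing F] (a : Fin n ⊕ Fin n → F) : om a a = 0 := by
  rw [om_eq]
  exact Finset.sum_eq_zero fun i _ => by ring

theorem om_J {F : Type*} [CommRing F] (d z : Fin n ⊕ Fin n → F) :
    om (Jmat n F *ᵥ d) z = d ⬝ᵥ z := by
  rw [om, Matrix.dotProduct_mulVec, Matrix.vecMul_mulVec, Jmat_transpose]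
  simp [Jmat_sq]

theorem sim_iff {F : Type*} [CommRing F] (k : Matrix (Fin n ⊕ Fin n) (Fin n ⊕ Fin n) F)
    (h : ∀ z t, om (k *ᵥ z) (k *ᵥ t) = om z t) : kᵀ * Jmat n F * k = Jmat n F := by
  ext i j
  have := h (Pi.single i 1) (Pi.single j 1)
  simp only [om, Matrix.mulVec_single_one, single_one_dotProduct] at this
  rw [Matrix.mul_assoc, Matrix.mul_apply]
  simpa [dotProduct, Matrix.mulVec, Matrix.mul_apply] using this

/-- Eichler transformation. -/
theorem eichler (y : Fin n ⊕ Fin n) (w : Fin n ⊕ Fin n → ℚ_[p]) (hw : ∀ z, ‖w z‖ ≤ 1)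
    (hy : w y = 1) :
    ∃ k : Matrix (Fin n ⊕ Fin n) (Fin n ⊕ Fin n) ℚ_[p], IntM k ∧
      kᵀ * Jmat n ℚ_[p] * k = Jmat n ℚ_[p] ∧
      ∀ z, k *ᵥ z = z + om (Pi.single y 1) z • (Jmat n ℚ_[p] *ᵥ (Pi.single y 1 - w)) +
        (z y - w ⬝ᵥ z - (w ⬝ᵥ (Jmat n ℚ_[p] *ᵥ (Pi.single y 1 - w))) * om (Pi.single y 1) z) •
          Pi.single y 1 := by
  set e : Fin n ⊕ Fin n → ℚ_[p] := Pi.single y 1 with he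
  set v := Jmat n ℚ_[p] *ᵥ (e - w) with hv
  have hvz : ∀ z, om v z = z y - w ⬝ᵥ z := by
    intro z
    rw [hv, om_J, sub_dotProduct, he, single_one_dotProduct]
  let f := e ᵥ* Jmat n ℚ_[p]
  have hf : ∀ z, om e z = f ⬝ᵥ z := fun z => by rw [om, Matrix.dotProduct_mulVec]
  have hk : ∀ z, (1 + vecMulVec v f + vecMulVec e (e - w) - (w ⬝ᵥ v) • vecMulVec e f) *ᵥ z
      = z + om e z • v + (z y - w ⬝ᵥ z - (w ⬝ᵥ v) * om e z) • e := by
    intro z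
    simp only [Matrix.add_mulVec, Matrix.sub_mulVec, Matrix.smul_mulVec, Matrix.vecMulVec_mulVec,
      Matrix.one_mulVec, hf, sub_dotProduct]
    have : e ⬝ᵥ z = z y := by rw [he, single_one_dotProduct]
    rw [this]
    ext t
    simp
    ring
  refine ⟨_, ?_, sim_iff _ ?_, hk⟩
  · have he1 : ∀ z, ‖e z‖ ≤ 1 := by
      intro z
      rw [he, Pi.single_apply]; split_ifs <;> simp
    have hd1 : ∀ z, ‖(e - w) z‖ ≤ 1 := by
      intro z
      rw [Pi.sub_apply, sub_eq_add_neg]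
      refine (IsUltrametricDist.norm_add_le_max _ _).trans (max_le (he1 z) ?_)
      rw [norm_neg]; exact hw z
    have hdot : ∀ a b : Fin n ⊕ Fin n → ℚ_[p], (∀ z, ‖a z‖ ≤ 1) → (∀ z, ‖b z‖ ≤ 1) →
        ‖a ⬝ᵥ b‖ ≤ 1 := by
      intro a b ha hb
      refine norm_sum_le' _ _ zero_le_one fun z _ => ?_
      rw [norm_mul]
      exact mul_le_one₀ (ha z) (norm_nonneg _) (hb z)
    have hv1 : ∀ z, ‖v z‖ ≤ 1 := fun z => hdot _ _ (fun t => intM_J z t) hd1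
    have hf1 : ∀ z, ‖f z‖ ≤ 1 := fun z => hdot _ _ he1 (fun t => intM_J t z)
    have hadd : ∀ a b : ℚ_[p], ‖a‖ ≤ 1 → ‖b‖ ≤ 1 → ‖a + b‖ ≤ 1 := fun a b ha hb =>
      (IsUltrametricDist.norm_add_le_max _ _).trans (max_le ha hb)
    have hmul : ∀ a b : ℚ_[p], ‖a‖ ≤ 1 → ‖b‖ ≤ 1 → ‖a * b‖ ≤ 1 := fun a b ha hb => by
      rw [norm_mul]
      exact mul_le_one₀ ha (norm_nonneg _) hb
    intro i j
    rw [Matrix.sub_apply, sub_eq_add_neg, Matrix.add_apply, Matrix.add_apply]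
    refine hadd _ _ (hadd _ _ (hadd _ _ ?_ ?_) ?_) ?_
    · rw [Matrix.one_apply]; split_ifs <;> simp
    · exact hmul _ _ (hv1 _) (hf1 _)
    · exact hmul _ _ (he1 _) (hd1 _)
    · rw [norm_neg]
      exact hmul _ _ (hdot _ _ hw hv1) (hmul _ _ (he1 _) (hf1 _))
  · intro z t
    have h1 : om v e = 0 := by
      rw [hvz, he, dotProduct_single_one, hy]; simp
    have h2 : om e v = 0 := by rw [om_swap, h1, neg_zero]
    rw [hk, hk, ← hvz, ← hvz]
    simp only [om_add_left, om_add_right, om_smul_left, om_smul_right, om_self, h1, h2]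
    rw [om_swap z v, om_swap z e]
    ring

/-- Invariant for the induction: processed pairs of columns. -/
def Good (A : Matrix (Fin n ⊕ Fin n) (Fin n ⊕ Fin n) ℚ_[p]) (r : ℚ_[p]) (i : Fin n) : Prop :=
  ∀ x₁ x₂, ‖A x₁ (Sum.inl i)‖ * ‖A x₂ (Sum.inr i)‖ ≤ ‖r‖

/-- Underlying pair index. -/
def pr : Fin n ⊕ Fin n → Fin n := Sum.elim id id

theorem step (A : Matrix (Fin n ⊕ Fin n) (Fin n ⊕ Fin n) ℚ_[p]) (r : ℚ_[p]) (hr : r ≠ 0)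
    (hA : Aᵀ * Jmat n ℚ_[p] * A = r • Jmat n ℚ_[p]) (s : Finset (Fin n)) (hs : ∃ i, i ∉ s)
    (hgood : ∀ i ∈ s, Good A r i) :
    ∃ k : Matrix (Fin n ⊕ Fin n) (Fin n ⊕ Fin n) ℚ_[p], IntM k ∧
      kᵀ * Jmat n ℚ_[p] * k = Jmat n ℚ_[p] ∧ ∃ j, j ∉ s ∧ ∀ i ∈ insert j s, Good (A * k) r i := by
  classical
  obtain ⟨i₀, hi₀⟩ := hs
  obtain ⟨⟨x, y⟩, hxy, hmax⟩ := Finset.exists_max_image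
    ((Finset.univ : Finset ((Fin n ⊕ Fin n) × (Fin n ⊕ Fin n))).filter fun q => pr q.2 ∉ s)
    (fun q => ‖A q.1 q.2‖) ⟨(Sum.inl i₀, Sum.inl i₀), by
      refine Finset.mem_filter.2 ⟨Finset.mem_univ _, ?_⟩
      exact hi₀⟩
  have hys : pr y ∉ s := by simpa using hxy
  have hmax' : ∀ x' y', pr y' ∉ s → ‖A x' y'‖ ≤ ‖A x y‖ := fun x' y' h =>
    hmax (x', y') (by simpa using h)
  set a := A x y with ha
  have ha0 : a ≠ 0 := by
    intro h0
    rw [h0, norm_zero] at hmax'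
    have hz : ∀ x', A x' y = 0 := fun x' => norm_le_zero_iff.1 (hmax' x' y hys)
    have hi := sim_inv hr hA
    have := congrFun (congrFun hi y) y
    rw [Matrix.mul_apply, Finset.sum_eq_zero (fun t _ => by rw [hz, mul_zero])] at this
    simp at this
  let w : Fin n ⊕ Fin n → ℚ_[p] := fun z => if pr z ∈ s then 0 else A x z / a
  have hw : ∀ z, ‖w z‖ ≤ 1 := by
    intro z
    simp only [w]
    split_ifs with h
    · simp
    · rw [norm_div]
      exact div_le_one_of_le₀ (hmax' x z h) (norm_nonneg _)
  have hwy : w y = 1 := by simp [w, hys, ← ha, ha0]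
  obtain ⟨k, hk1, hk2, hk⟩ := eichler y w hw hwy
  refine ⟨k, hk1, hk2, pr y, hys, ?_⟩
  have hcol : ∀ x' z, (A * k) x' z = (A *ᵥ (k *ᵥ Pi.single z 1)) x' := by
    intro x' z
    rw [Matrix.mulVec_mulVec, Matrix.mulVec_single_one]; rfl
  have homs : ∀ z, pr z ≠ pr y → om (Pi.single y 1) (Pi.single z (1 : ℚ_[p])) = 0 := by
    intro z hz
    rw [om, single_one_dotProduct, Matrix.mulVec_single_one]
    rcases y with y | y <;> rcases z with z | z <;> simp [pr] at hz <;>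
      simp [Jmat, Matrix.one_apply, Ne.symm hz]
  have hold : ∀ z, pr z ∈ s → k *ᵥ Pi.single z 1 = Pi.single z 1 := by
    intro z hz
    have hzy : pr z ≠ pr y := fun h => hys (h ▸ hz)
    have hne : y ≠ z := by rintro rfl; exact hzy rfl
    rw [hk, homs z hzy, dotProduct_single_one]
    simp [w, hz, hne]
  have hky : k *ᵥ Pi.single y 1 = Pi.single y 1 := by
    rw [hk, om_self, dotProduct_single_one, hwy]; simp
  have hnew : ∀ z, pr z ∉ s → z ≠ y → (A * k) x z = 0 := by
    intro z hz hzy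
    rw [hcol, hk]
    set d : Fin n ⊕ Fin n → ℚ_[p] := Pi.single y 1 - w with hd
    set v := Jmat n ℚ_[p] *ᵥ d with hv
    have hvs : ∀ t, pr t ∈ s → v t = 0 := by
      intro t ht
      have hds : ∀ t, pr t ∈ s → d t = 0 := by
        intro t ht
        have : t ≠ y := by rintro rfl; exact hys ht
        simp [hd, w, ht, this]
      rcases t with t | t
      · have := hds (Sum.inr t) ht
        simp [hv, Jmat, Matrix.mulVec, dotProduct, Matrix.one_apply, this]
      · have := hds (Sum.inl t) ht
        simp [hv, Jmat, Matrix.mulVec, dotProduct, Matrix.one_apply, this]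
    have hAv : (A *ᵥ v) x = a * (w ⬝ᵥ v) := by
      simp only [Matrix.mulVec, dotProduct, Finset.mul_sum]
      refine Finset.sum_congr rfl fun t _ => ?_
      by_cases ht : pr t ∈ s
      · simp [hvs t ht]
      · simp only [w, if_neg ht]; field_simp
    rw [Matrix.mulVec_add, Matrix.mulVec_add, Matrix.mulVec_smul, Matrix.mulVec_smul,
      Matrix.mulVec_single_one, Matrix.mulVec_single_one]
    simp only [Pi.add_apply, Pi.smul_apply, hAv, smul_eq_mul, Matrix.col_apply, dotProduct_single_one, ← ha]
    simp only [w, if_neg hz, Pi.single_eq_of_ne' hzy]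
    field_simp
    ring
  have hAy : ∀ x', (A * k) x' y = A x' y := by
    intro x'; rw [hcol, hky, Matrix.mulVec_single_one]; rfl
  have hAs : ∀ x' z, pr z ∈ s → (A * k) x' z = A x' z := by
    intro x' z hz; rw [hcol, hold z hz, Matrix.mulVec_single_one]; rfl
  have hgs : ∀ i ∈ s, Good (A * k) r i := by
    intro i hi x₁ x₂
    rw [hAs _ (Sum.inl i) hi, hAs _ (Sum.inr i) hi]
    exact hgood i hi x₁ x₂
  have hAk : (A * k)ᵀ * Jmat n ℚ_[p] * (A * k) = r • Jmat n ℚ_[p] := by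
    have := sim_mul hA (v := 1) (b := k) (by rw [hk2, one_smul])
    rwa [mul_one] at this
  have hT := sim_transpose hr hAk
  set B := A * k with hB
  have hrow : ∀ t, ∑ i, (B t (Sum.inl i) * B x (Sum.inr i) - B t (Sum.inr i) * B x (Sum.inl i))
      = r * Jmat n ℚ_[p] t x := by
    intro t
    have := congrFun (congrFun hT t) x
    rw [Matrix.smul_apply, smul_eq_mul, Matrix.mul_assoc] at this
    rw [← this, ← om_eq (B t) (B x)]
    rfl
  have hbd : ∀ t, ‖B t (Sum.inl (pr y)) * B x (Sum.inr (pr y)) -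
      B t (Sum.inr (pr y)) * B x (Sum.inl (pr y))‖ ≤ ‖r‖ := by
    intro t
    have h := hrow t
    rw [← Finset.add_sum_erase _ _ (Finset.mem_univ (pr y))] at h
    rw [eq_sub_of_add_eq h, sub_eq_add_neg]
    refine (IsUltrametricDist.norm_add_le_max _ _).trans (max_le ?_ ?_)
    · rw [norm_mul]
      exact mul_le_of_le_one_right (norm_nonneg _) (intM_J _ _)
    · rw [norm_neg]
      refine norm_sum_le' _ _ (norm_nonneg _) fun i hi => ?_
      have hiy : i ≠ pr y := Finset.ne_of_mem_erase hi
      by_cases his : i ∈ s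
      · rw [sub_eq_add_neg]
        refine (IsUltrametricDist.norm_add_le_max _ _).trans (max_le ?_ ?_)
        · rw [norm_mul]; exact hgs i his _ _
        · rw [norm_neg, norm_mul, mul_comm]; exact hgs i his _ _
      · rw [hnew (Sum.inl i) his (by rintro rfl; exact hiy rfl),
          hnew (Sum.inr i) his (by rintro rfl; exact hiy rfl)]
        simp
  intro i hi
  rcases Finset.mem_insert.1 hi with rfl | hi
  · intro x₁ x₂
    rcases y with y | y
    · have h := hbd x₂
      simp only [pr, Sum.elim_inl, id] at h hys ⊢
      rw [hnew (Sum.inr y) hys (by simp), hAy x, ← ha] at h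
      rw [hAy]
      calc _ ≤ ‖a‖ * ‖B x₂ (Sum.inr y)‖ :=
            mul_le_mul_of_nonneg_right (hmax' _ (Sum.inl y) hys) (norm_nonneg _)
        _ ≤ _ := by simpa [mul_comm] using h
    · have h := hbd x₁
      simp only [pr, Sum.elim_inr, id] at h hys ⊢
      rw [hnew (Sum.inl y) hys (by simp), hAy x, ← ha] at h
      rw [hAy]
      calc _ ≤ ‖B x₁ (Sum.inl y)‖ * ‖a‖ :=
            mul_le_mul_of_nonneg_left (hmax' _ (Sum.inr y) hys) (norm_nonneg _)
        _ ≤ _ := by simpa using h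
  · exact hgs i hi

theorem all_good (A : Matrix (Fin n ⊕ Fin n) (Fin n ⊕ Fin n) ℚ_[p]) (r : ℚ_[p]) (hr : r ≠ 0)
    (hA : Aᵀ * Jmat n ℚ_[p] * A = r • Jmat n ℚ_[p]) :
    ∃ k : Matrix (Fin n ⊕ Fin n) (Fin n ⊕ Fin n) ℚ_[p], IntM k ∧
      kᵀ * Jmat n ℚ_[p] * k = Jmat n ℚ_[p] ∧ ∀ i, Good (A * k) r i := by
  have key : ∀ m ≤ n, ∃ k : Matrix (Fin n ⊕ Fin n) (Fin n ⊕ Fin n) ℚ_[p], IntM k ∧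
      kᵀ * Jmat n ℚ_[p] * k = Jmat n ℚ_[p] ∧ ∃ s : Finset (Fin n), s.card = m ∧
        ∀ i ∈ s, Good (A * k) r i := by
    intro m
    induction m with
    | zero =>
      intro _
      refine ⟨1, ?_, by simp, ∅, by simp, by simp⟩
      intro i j
      rw [Matrix.one_apply]; split_ifs <;> simp
    | succ m ih =>
      intro hm
      obtain ⟨k, hk1, hk2, s, hs, hg⟩ := ih (by omega)
      have hAk : (A * k)ᵀ * Jmat n ℚ_[p] * (A * k) = r • Jmat n ℚ_[p] := by
        have := sim_mul hA (v := 1) (b := k) (by rw [hk2, one_smul])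
        rwa [mul_one] at this
      have hex : ∃ i, i ∉ s := by
        by_contra! h
        have : s = Finset.univ := Finset.eq_univ_iff_forall.2 h
        rw [this, Finset.card_univ, Fintype.card_fin] at hs
        omega
      obtain ⟨k', hk1', hk2', j, hj, hg'⟩ := step (A * k) r hr hAk s hex hg
      refine ⟨k * k', hk1.mul hk1', ?_, insert j s, by rw [Finset.card_insert_of_notMem hj, hs], ?_⟩
      · have := sim_mul (u := 1) (v := 1) (a := k) (b := k') (by rw [hk2, one_smul]) (by rw [hk2', one_smul])
        simpa using this
      · rw [← Matrix.mul_assoc]; exact hg'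
  obtain ⟨k, hk1, hk2, s, hs, hg⟩ := key n le_rfl
  have : s = Finset.univ := by
    rw [← Finset.card_eq_iff_eq_univ, hs, Fintype.card_fin]
  exact ⟨k, hk1, hk2, fun i => hg i (this ▸ Finset.mem_univ i)⟩

theorem pp_pos : (0 : ℝ) < p := by exact_mod_cast (Fact.out : p.Prime).pos
theorem pp_one : (1 : ℝ) < p := by exact_mod_cast (Fact.out : p.Prime).one_lt

/-- The matrix `λ(p)`. -/
noncomputable def lam (p : ℕ) [Fact p.Prime] (l₀ : ℤ) (l : Fin n → ℤ) :
    Matrix (Fin n ⊕ Fin n) (Fin n ⊕ Fin n) ℚ_[p] :=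
  Matrix.fromBlocks
    (Matrix.diagonal fun i : Fin n => (p : ℚ_[p]) ^ (l i)) 0 0
    (Matrix.diagonal fun i : Fin n => (p : ℚ_[p]) ^ (l₀ - l i))

theorem lam_eq (l₀ : ℤ) (l : Fin n → ℤ) : lam p l₀ l =
    Matrix.diagonal fun z => (p : ℚ_[p]) ^ (Sum.elim l (fun i => l₀ - l i) z) := by
  rw [lam, Matrix.fromBlocks_diagonal]
  congr 1
  ext z
  rcases z with z | z <;> rfl

theorem lam_sim (l₀ : ℤ) (l : Fin n → ℤ) :
    (lam p l₀ l)ᵀ * Jmat n ℚ_[p] * lam p l₀ l = ((p : ℚ_[p]) ^ l₀) • Jmat n ℚ_[p] := by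
  have hp : (p : ℚ_[p]) ≠ 0 := by exact_mod_cast (Fact.out : p.Prime).ne_zero
  have h1 : ∀ i, (p : ℚ_[p]) ^ (l i) * (p : ℚ_[p]) ^ (l₀ - l i) = (p : ℚ_[p]) ^ l₀ := by
    intro i; rw [← zpow_add₀ hp]; congr 1; ring
  have h2 : ∀ i, (p : ℚ_[p]) ^ (l₀ - l i) * (p : ℚ_[p]) ^ (l i) = (p : ℚ_[p]) ^ l₀ := by
    intro i; rw [mul_comm, h1]
  simp only [lam, Jmat, Matrix.fromBlocks_transpose, Matrix.fromBlocks_multiply,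
    Matrix.fromBlocks_smul]
  simp [Matrix.diagonal_transpose, Matrix.diagonal_mul_diagonal, h1, h2,
    ← Matrix.smul_one_eq_diagonal]

theorem sum_first {m : ℕ} (hm : m ≤ n) (hm1 : 1 ≤ m) (l₀ : ℤ) (l : Fin n → ℤ) (hl : Monotone l)
    (hl0 : ∀ i, 2 * l i ≤ l₀) (κ : Fin m → Fin n ⊕ Fin n) (hκ : Function.Injective κ) :
    ∑ i : Fin m, l (Fin.castLE hm i) ≤ ∑ i, Sum.elim l (fun i => l₀ - l i) (κ i) := by
  classical
  set v := Sum.elim l (fun i => l₀ - l i) with hv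
  let q : Fin n := ⟨m - 1, by omega⟩
  set t := l q with ht
  let S : Finset (Fin n ⊕ Fin n) :=
    Finset.univ.image (fun i : Fin m => (Sum.inl (Fin.castLE hm i) : Fin n ⊕ Fin n))
  let T := Finset.univ.image κ
  have hS : ∑ z ∈ S, (v z - t) = ∑ i : Fin m, (l (Fin.castLE hm i) - t) := by
    rw [Finset.sum_image]
    · rfl
    · intro i _ j _ h
      simpa using h
  have hT : ∑ z ∈ T, (v z - t) = ∑ i : Fin m, (v (κ i) - t) := by
    rw [Finset.sum_image]
    intro i _ j _ h
    exact hκ h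
  have hin : ∀ z ∈ S, v z - t ≤ 0 := by
    intro z hz
    obtain ⟨i, _, rfl⟩ := Finset.mem_image.1 hz
    have : l (Fin.castLE hm i) ≤ t := hl (by
      rw [Fin.le_def]; simp [q]; omega)
    simp only [hv, Sum.elim_inl]
    linarith
  have hout : ∀ z, z ∉ S → 0 ≤ v z - t := by
    intro z hz
    rcases z with z | z
    · have : t ≤ l z := hl (by
        by_contra! h
        apply hz
        rw [Fin.lt_def] at h
        refine Finset.mem_image.2 ⟨⟨z, by simp [q] at h; omega⟩, Finset.mem_univ _, ?_⟩
        simp [Fin.castLE])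
      simp only [hv, Sum.elim_inl]; linarith
    · have h1 := hl0 z
      have h2 := hl0 q
      simp only [hv, Sum.elim_inr]
      linarith
  have h1 : ∑ z ∈ S, (v z - t) ≤ ∑ z ∈ S ∩ T, (v z - t) := by
    rw [← Finset.sum_inter_add_sum_sdiff S T]
    have : ∑ z ∈ S \ T, (v z - t) ≤ 0 :=
      Finset.sum_nonpos fun z hz => hin z (Finset.mem_sdiff.1 hz).1
    linarith
  have h2 : ∑ z ∈ S ∩ T, (v z - t) ≤ ∑ z ∈ T, (v z - t) := by
    rw [← Finset.sum_inter_add_sum_sdiff T S, Finset.inter_comm]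
    have : 0 ≤ ∑ z ∈ T \ S, (v z - t) :=
      Finset.sum_nonneg fun z hz => hout z (Finset.mem_sdiff.1 hz).2
    linarith
  have h3 := h1.trans h2
  rw [hS, hT, Finset.sum_sub_distrib, Finset.sum_sub_distrib] at h3
  linarith

theorem prod_norm {ι : Type*} (s : Finset ι) (v : ι → ℤ) :
    ∏ i ∈ s, ‖(p : ℚ_[p]) ^ (v i)‖ = (p : ℝ) ^ (-∑ i ∈ s, v i) := by
  classical
  induction s using Finset.induction_on with
  | empty => simp
  | insert a s ha ih =>
    rw [Finset.prod_insert ha, Finset.sum_insert ha, ih, Padic.norm_p_zpow, neg_add,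
      zpow_add₀ (pp_pos (p := p)).ne']

theorem lam_greatest {m : ℕ} (hm : m ≤ n) (hm1 : 1 ≤ m) (l₀ : ℤ) (l : Fin n → ℤ) (hl : Monotone l)
    (hl0 : ∀ i, 2 * l i ≤ l₀) :
    IsGreatest (minorSet m (lam p l₀ l)) ((p : ℝ) ^ (-∑ i : Fin m, l (Fin.castLE hm i))) := by
  rw [lam_eq]
  constructor
  · have hinj : Function.Injective (fun i : Fin m => (Sum.inl (Fin.castLE hm i) : Fin n ⊕ Fin n)) := by
      intro i j h
      simpa using h
    refine ⟨_, _, hinj, hinj, ?_⟩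
    rw [Matrix.submatrix_diagonal _ _ hinj, Matrix.det_diagonal, norm_prod]
    exact (prod_norm Finset.univ fun i : Fin m => l (Fin.castLE hm i)).symm
  · rintro s ⟨ρ, κ, hρ, hκ, rfl⟩
    have hb := sum_first hm hm1 l₀ l hl hl0 κ hκ
    set v := Sum.elim l (fun i => l₀ - l i) with hv
    have h1 : (p : ℝ) ^ (-∑ i, v (κ i)) ≤ (p : ℝ) ^ (-∑ i : Fin m, l (Fin.castLE hm i)) :=
      zpow_le_zpow_right₀ pp_one.le (by linarith)
    refine le_trans ?_ h1
    rw [Matrix.det_apply']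
    refine norm_sum_le' _ _ (zpow_pos (pp_pos (p := p)) _).le fun σ _ => ?_
    rw [← prod_norm, norm_mul, norm_prod]
    have hs : ‖((Equiv.Perm.sign σ : ℤ) : ℚ_[p])‖ ≤ 1 := Padic.norm_int_le_one _
    refine (mul_le_of_le_one_left (Finset.prod_nonneg fun _ _ => norm_nonneg _) hs).trans ?_
    refine Finset.prod_le_prod (fun _ _ => norm_nonneg _) fun i _ => ?_
    rw [Matrix.submatrix_apply, Matrix.diagonal_apply]
    split_ifs with h
    · rw [h]
    · rw [norm_zero]; exact norm_nonneg _

theorem col_exp (B : Matrix (Fin n ⊕ Fin n) (Fin n ⊕ Fin n) ℚ_[p]) (r : ℚ_[p]) (hr : r ≠ 0)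
    (hB : Bᵀ * Jmat n ℚ_[p] * B = r • Jmat n ℚ_[p]) (z : Fin n ⊕ Fin n) :
    ∃ e : ℤ, (∀ x, ‖B x z‖ ≤ (p : ℝ) ^ (-e)) ∧ ∃ x, ‖B x z‖ = (p : ℝ) ^ (-e) := by
  have : Nonempty (Fin n ⊕ Fin n) := ⟨z⟩
  obtain ⟨x, hx⟩ := Finite.exists_max (fun x => ‖B x z‖)
  have h0 : B x z ≠ 0 := by
    intro h0
    rw [h0, norm_zero] at hx
    have hz : ∀ x', B x' z = 0 := fun x' => norm_le_zero_iff.1 (hx x')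
    have hi := sim_inv hr hB
    have := congrFun (congrFun hi z) z
    rw [Matrix.mul_apply, Finset.sum_eq_zero (fun t _ => by rw [hz, mul_zero])] at this
    simp at this
  have he := Padic.norm_eq_zpow_neg_valuation h0
  exact ⟨(B x z).valuation, fun x' => he ▸ hx x', x, he⟩

theorem orient (b : Fin n → Prop) [DecidablePred b] :
    ∃ k : Matrix (Fin n ⊕ Fin n) (Fin n ⊕ Fin n) ℚ_[p], IntM k ∧
      kᵀ * Jmat n ℚ_[p] * k = Jmat n ℚ_[p] ∧
      ∀ (B : Matrix (Fin n ⊕ Fin n) (Fin n ⊕ Fin n) ℚ_[p]) x i,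
        (B * k) x (Sum.inl i) = (if b i then B x (Sum.inr i) else B x (Sum.inl i)) ∧
        (B * k) x (Sum.inr i) = (if b i then - B x (Sum.inl i) else B x (Sum.inr i)) := by
  refine ⟨Matrix.fromBlocks (Matrix.diagonal fun i => if b i then 0 else 1)
    (Matrix.diagonal fun i => if b i then -1 else 0) (Matrix.diagonal fun i => if b i then 1 else 0)
    (Matrix.diagonal fun i => if b i then 0 else 1), ?_, ?_, ?_⟩
  · rintro (i | i) (j | j) <;> simp [Matrix.diagonal_apply] <;> split_ifs <;> simp
  · simp only [Jmat, Matrix.fromBlocks_transpose, Matrix.fromBlocks_multiply,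
      Matrix.diagonal_transpose]
    simp only [Matrix.mul_zero, Matrix.mul_one, Matrix.mul_neg, zero_add, add_zero, Matrix.neg_mul,
      Matrix.diagonal_mul_diagonal, Matrix.diagonal_neg, Matrix.diagonal_add]
    congr 1
    all_goals
      ext i j
      by_cases h : i = j
      · subst h
        by_cases hb : b i <;> simp [hb]
      · simp [Matrix.diagonal_apply, h]
  · intro B x i
    constructor
    · by_cases hb : b i <;>
      simp [Matrix.mul_apply, Fintype.sum_sum_type, Matrix.diagonal_apply, hb]
    · by_cases hb : b i <;>
      simp [Matrix.mul_apply, Fintype.sum_sum_type, Matrix.diagonal_apply, hb]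

theorem permute (τ : Equiv.Perm (Fin n)) :
    ∃ k : Matrix (Fin n ⊕ Fin n) (Fin n ⊕ Fin n) ℚ_[p], IntM k ∧
      kᵀ * Jmat n ℚ_[p] * k = Jmat n ℚ_[p] ∧
      ∀ (B : Matrix (Fin n ⊕ Fin n) (Fin n ⊕ Fin n) ℚ_[p]) x i,
        (B * k) x (Sum.inl i) = B x (Sum.inl (τ i)) ∧
        (B * k) x (Sum.inr i) = B x (Sum.inr (τ i)) := by
  have hP : ∀ B : Matrix (Fin n ⊕ Fin n) (Fin n ⊕ Fin n) ℚ_[p],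
      B * (1 : Matrix (Fin n ⊕ Fin n) (Fin n ⊕ Fin n) ℚ_[p]).submatrix id (Sum.map τ τ) =
        B.submatrix id (Sum.map τ τ) := by
    intro B
    ext i j
    simp [Matrix.mul_apply, Matrix.one_apply]
  refine ⟨(1 : Matrix (Fin n ⊕ Fin n) (Fin n ⊕ Fin n) ℚ_[p]).submatrix id (Sum.map τ τ), ?_, ?_, ?_⟩
  · intro i j
    rw [Matrix.submatrix_apply, Matrix.one_apply]; split_ifs <;> simp
  · rw [hP]
    ext i j
    simp only [Matrix.submatrix_apply, Matrix.mul_apply, Matrix.transpose_apply, Matrix.one_apply, id]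
    rcases i with i | i <;> rcases j with j | j <;> simp [Jmat, Matrix.one_apply, eq_comm]
  · intro B x i
    rw [hP]
    exact ⟨rfl, rfl⟩

theorem cartan (g : Matrix (Fin n ⊕ Fin n) (Fin n ⊕ Fin n) ℚ_[p]) (r : ℚ_[p]) (hr : r ≠ 0)
    (hg : gᵀ * Jmat n ℚ_[p] * g = r • Jmat n ℚ_[p]) (l₀ : ℤ) (hl₀ : ‖r‖ = (p : ℝ) ^ (-l₀)) :
    ∃ (l : Fin n → ℤ) (k₁ k₂ : Matrix (Fin n ⊕ Fin n) (Fin n ⊕ Fin n) ℚ_[p]),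
      Monotone l ∧ (∀ i, 2 * l i ≤ l₀) ∧ KQ k₁ ∧ KQ k₂ ∧ k₁ * g * k₂ = lam p l₀ l := by
  classical
  have hp : (p : ℚ_[p]) ≠ 0 := by exact_mod_cast (Fact.out : p.Prime).ne_zero
  obtain ⟨k, hk1, hk2, hgood⟩ := all_good g r hr hg
  have hA : (g * k)ᵀ * Jmat n ℚ_[p] * (g * k) = r • Jmat n ℚ_[p] := by
    have := sim_mul hg (v := 1) (b := k) (by rw [hk2, one_smul])
    rwa [mul_one] at this
  set A := g * k with hAdef
  choose e he1 he2 using col_exp A r hr hA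
  have hsum : ∀ i, e (Sum.inl i) + e (Sum.inr i) = l₀ := by
    intro i
    apply le_antisymm
    · have h : om (fun x => A x (Sum.inl i)) (fun x => A x (Sum.inr i)) = r := by
        have := congrFun (congrFun hA (Sum.inl i)) (Sum.inr i)
        rw [Matrix.mul_assoc] at this
        have h2 : (r • Jmat n ℚ_[p]) (Sum.inl i) (Sum.inr i) = r := by simp [Jmat]
        rw [h2] at this
        rw [← this]
        rfl
      have h3 : ‖r‖ ≤ (p : ℝ) ^ (-(e (Sum.inl i) + e (Sum.inr i))) := by
        rw [← h, om]
        refine norm_sum_le' _ _ (zpow_pos (pp_pos (p := p)) _).le fun x _ => ?_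
        rw [norm_mul, neg_add, zpow_add₀ (pp_pos (p := p)).ne']
        refine mul_le_mul (he1 _ _) ?_ (norm_nonneg _) (zpow_pos (pp_pos (p := p)) _).le
        simp only [Matrix.mulVec, dotProduct]
        refine norm_sum_le' (p := p) _ _ (zpow_pos (pp_pos (p := p)) _).le fun x' _ => ?_
        rw [norm_mul]
        exact (mul_le_of_le_one_left (norm_nonneg _) (intM_J _ _)).trans (he1 _ _)
      rw [hl₀, zpow_le_zpow_iff_right₀ (pp_one (p := p))] at h3
      linarith
    · obtain ⟨x₁, h1⟩ := he2 (Sum.inl i)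
      obtain ⟨x₂, h2⟩ := he2 (Sum.inr i)
      have := hgood i x₁ x₂
      rw [h1, h2, hl₀, ← zpow_add₀ (pp_pos (p := p)).ne', zpow_le_zpow_iff_right₀ (pp_one (p := p))] at this
      linarith
  let mn : Fin n → ℤ := fun i => if e (Sum.inr i) < e (Sum.inl i) then e (Sum.inr i) else e (Sum.inl i)
  obtain ⟨k', hk1', hk2', hk'⟩ := orient (p := p) (fun i => e (Sum.inr i) < e (Sum.inl i))
  obtain ⟨k'', hk1'', hk2'', hk''⟩ := permute (p := p) (Tuple.sort mn)
  let l := mn ∘ Tuple.sort mn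
  have hmn : ∀ i, 2 * mn i ≤ l₀ := by
    intro i
    have := hsum i
    simp only [mn]
    split_ifs <;> omega
  have hL : ∀ x i, ‖(A * k') x (Sum.inl i)‖ ≤ (p : ℝ) ^ (-mn i) := by
    intro x i
    rw [(hk' A x i).1]
    simp only [mn]
    split_ifs
    · exact he1 _ _
    · exact he1 _ _
  have hR : ∀ x i, ‖(A * k') x (Sum.inr i)‖ ≤ (p : ℝ) ^ (-(l₀ - mn i)) := by
    intro x i
    rw [(hk' A x i).2]
    have := hsum i
    simp only [mn]
    split_ifs
    · rw [norm_neg, show l₀ - e (Sum.inr i) = e (Sum.inl i) by omega]; exact he1 _ _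
    · rw [show l₀ - e (Sum.inl i) = e (Sum.inr i) by omega]; exact he1 _ _
  have K : ∀ k : Matrix (Fin n ⊕ Fin n) (Fin n ⊕ Fin n) ℚ_[p], IntM k →
      kᵀ * Jmat n ℚ_[p] * k = Jmat n ℚ_[p] → KQ k := fun k h1 h2 =>
    ⟨h1, 1, by simp, by rw [h2, one_smul]⟩
  have hKK : KQ (k * k' * k'') := ((K k hk1 hk2).mul (K k' hk1' hk2')).mul (K k'' hk1'' hk2'')
  let v : Fin n ⊕ Fin n → ℤ := Sum.elim l (fun i => l₀ - l i)
  let D' : Matrix (Fin n ⊕ Fin n) (Fin n ⊕ Fin n) ℚ_[p] :=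
    Matrix.diagonal fun z => (p : ℚ_[p]) ^ (-(v z))
  have hD : D' * lam p l₀ l = 1 := by
    rw [lam_eq, Matrix.diagonal_mul_diagonal, ← Matrix.diagonal_one]
    congr 1
    ext z
    rw [← zpow_add₀ hp]; simp [v]
  have hD2 : lam p l₀ l * D' = 1 := mul_eq_one_comm.1 hD
  have hD' : D'ᵀ * Jmat n ℚ_[p] * D' = ((p : ℚ_[p]) ^ (-l₀)) • Jmat n ℚ_[p] := by
    have h := lam_sim (p := p) l₀ l
    have h2 : D'ᵀ * ((lam p l₀ l)ᵀ * Jmat n ℚ_[p] * lam p l₀ l) * D' = Jmat n ℚ_[p] := by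
      have : D'ᵀ * ((lam p l₀ l)ᵀ * Jmat n ℚ_[p] * lam p l₀ l) * D' =
          (lam p l₀ l * D')ᵀ * Jmat n ℚ_[p] * (lam p l₀ l * D') := by
        simp only [Matrix.transpose_mul, Matrix.mul_assoc]
      rw [this, hD2]; simp
    rw [h, Matrix.mul_smul, Matrix.smul_mul] at h2
    rw [← h2, smul_smul, ← zpow_add₀ hp, h2]; simp
  have hC : KQ (g * (k * k' * k'') * D') := by
    refine ⟨?_, ?_⟩
    · intro x z
      have e1 : g * (k * k' * k'') = A * k' * k'' := by simp only [hAdef, Matrix.mul_assoc]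
      rw [e1, Matrix.mul_diagonal, norm_mul, Padic.norm_p_zpow, neg_neg]
      have : ‖(A * k' * k'') x z‖ ≤ (p : ℝ) ^ (-(v z)) := by
        rcases z with z | z
        · rw [(hk'' _ x z).1]; exact hL _ _
        · rw [(hk'' _ x z).2]; exact hR _ _
      calc _ ≤ (p : ℝ) ^ (-(v z)) * (p : ℝ) ^ (v z) :=
            mul_le_mul_of_nonneg_right this (zpow_pos (pp_pos (p := p)) _).le
        _ = 1 := by rw [← zpow_add₀ (pp_pos (p := p)).ne']; simp
    · obtain ⟨_, u, hu, hku⟩ := hKK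
      refine ⟨r * u * (p : ℚ_[p]) ^ (-l₀), ?_, sim_mul (sim_mul hg hku) hD'⟩
      rw [norm_mul, norm_mul, hu, hl₀, Padic.norm_p_zpow, mul_one, ← zpow_add₀ (pp_pos (p := p)).ne']
      simp
  obtain ⟨b, hb, hb1, _⟩ := hC.inv
  refine ⟨l, b, _, Tuple.monotone_sort mn, fun i => hmn _, hb, hKK, ?_⟩
  calc b * g * (k * k' * k'') = b * (g * (k * k' * k'')) * (D' * lam p l₀ l) := by
        rw [hD]; simp only [Matrix.mul_assoc, Matrix.mul_one]
    _ = (b * (g * (k * k' * k'') * D')) * lam p l₀ l := by simp only [Matrix.mul_assoc]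
    _ = _ := by rw [hb1, Matrix.one_mul]

end helpers

/-- Cartan decomposition criterion for `GSp_{2n}(ℚ_p)` (Proposition `fp` of the paper):
`g` lies in `GSp_{2n}(ℤ_p)·λ(p)·GSp_{2n}(ℤ_p)` iff `|r(g)|_p = p^{−ℓ₀}` and for each
`1 ≤ m ≤ n` the maximum of the norms of the determinants of `m × m` submatrices of `g`
is `p^{−(ℓ₁+⋯+ℓₘ)}`. -/
theorem stmt_0 (p : ℕ) [Fact p.Prime] (n : ℕ) (hn : 1 ≤ n)
    (ℓ : Fin (n + 1) → ℤ)
    (hmono : ∀ i j : Fin n, i ≤ j → ℓ i.succ ≤ ℓ j.succ)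
    (hlast : 2 * ℓ (Fin.last n) ≤ ℓ 0)
    (g : Matrix (Fin n ⊕ Fin n) (Fin n ⊕ Fin n) ℚ_[p]) (r : ℚ_[p]) (hr : r ≠ 0)
    (hg : gᵀ * Jmat n ℚ_[p] * g = r • Jmat n ℚ_[p]) :
    (∃ k₁ k₂ : Matrix (Fin n ⊕ Fin n) (Fin n ⊕ Fin n) ℤ_[p],
        IsGSpZp p n k₁ ∧ IsGSpZp p n k₂ ∧
        k₁.map (fun a => (a : ℚ_[p])) * g * k₂.map (fun a => (a : ℚ_[p])) =
          Matrix.fromBlocks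
            (Matrix.diagonal fun i : Fin n => (p : ℚ_[p]) ^ (ℓ i.succ)) 0 0
            (Matrix.diagonal fun i : Fin n => (p : ℚ_[p]) ^ (ℓ 0 - ℓ i.succ))) ↔
      (‖r‖ = (p : ℝ) ^ (-(ℓ 0)) ∧
        ∀ m : ℕ, 1 ≤ m → (hm : m ≤ n) →
          IsGreatest
            {s : ℝ | ∃ ρ κ : Fin m → Fin n ⊕ Fin n,
              Function.Injective ρ ∧ Function.Injective κ ∧
              s = ‖(g.submatrix ρ κ).det‖}
            ((p : ℝ) ^ (-(∑ i : Fin m, ℓ (Fin.succ (Fin.castLE hm i)))))) := by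
  have hpos : ∀ z : ℤ, (0 : ℝ) < (p : ℝ) ^ z := fun z => zpow_pos pp_pos z
  have hm' : Monotone fun i : Fin n => ℓ i.succ := fun i j h => hmono i j h
  have hle : ∀ i : Fin n, 2 * ℓ i.succ ≤ ℓ 0 := by
    intro i
    have h1 := hmono i ⟨n - 1, by omega⟩ (by rw [Fin.le_def]; simp; omega)
    have h2 : (⟨n - 1, by omega⟩ : Fin n).succ = Fin.last n := by
      ext; simp; omega
    rw [h2] at h1
    linarith
  constructor
  · rintro ⟨k₁, k₂, h₁, h₂, h⟩
    have K₁ := kq_of_gsp h₁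
    have K₂ := kq_of_gsp h₂
    change _ = lam p (ℓ 0) (fun i => ℓ i.succ) at h
    refine ⟨?_, ?_⟩
    · obtain ⟨_, u, hu, hu'⟩ := K₁
      obtain ⟨_, v, hv, hv'⟩ := K₂
      have e := sim_mul (sim_mul hu' hg) hv'
      rw [h, lam_sim] at e
      have e2 := congrFun (congrFun e (Sum.inl ⟨0, hn⟩)) (Sum.inr ⟨0, hn⟩)
      simp only [Matrix.smul_apply, Jmat, Matrix.fromBlocks_apply₁₂, Matrix.one_apply_eq,
        smul_eq_mul, mul_one] at e2
      have e3 := congrArg norm e2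
      rw [norm_mul, norm_mul, hu, hv, one_mul, mul_one, Padic.norm_p_zpow] at e3
      exact e3.symm
    · intro m hm1 hm
      exact (greatest_equiv hn (hpos _) K₁ K₂ h).2 (lam_greatest hm hm1 _ _ hm' hle)
  · rintro ⟨h0, hM⟩
    obtain ⟨l, k₁, k₂, hl, hl0, K₁, K₂, h⟩ := cartan g r hr hg (ℓ 0) h0
    have hsum : ∀ m : ℕ, (hm : m ≤ n) →
        ∑ i : Fin m, l (Fin.castLE hm i) = ∑ i : Fin m, ℓ (Fin.succ (Fin.castLE hm i)) := by
      intro m hm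
      rcases Nat.eq_zero_or_pos m with rfl | hm1
      · simp
      · have g1 := (greatest_equiv hn (hpos _) K₁ K₂ h).2
          (lam_greatest (p := p) hm hm1 (ℓ 0) l hl hl0)
        have e := g1.unique (hM m hm1 hm)
        have e2 := zpow_right_injective₀ pp_pos pp_one.ne' e
        linarith
    have hll : l = fun i => ℓ i.succ := by
      funext i
      have h1 := hsum i i.2.le
      have h2 := hsum (i + 1) i.2
      rw [Fin.sum_univ_castSucc, Fin.sum_univ_castSucc] at h2
      have e1 : Fin.castLE i.2 (Fin.last (i : ℕ)) = i := by ext; simp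
      rw [e1] at h2
      have e2 : ∀ j : Fin i, Fin.castLE i.2 (Fin.castSucc j) = Fin.castLE i.2.le j := fun j => rfl
      simp only [e2] at h2
      linarith
    obtain ⟨k₁', G₁, rfl⟩ := gsp_of_kq K₁
    obtain ⟨k₂', G₂, rfl⟩ := gsp_of_kq K₂
    refine ⟨k₁', k₂', G₁, G₂, ?_⟩
    rw [h, hll]
    rfl
end

section
/- Let F be a field of characteristic 0, let n ≥ 1, and let b₁, …, bₙ ∈ F be such that bᵢ + bⱼ ≠ 0 for all 1 ≤ i ≤ j ≤ n and such that for every permutation σ of {1,…,n} and every k ∈ {1,…,n} the partial sum b_{σ(1)} + ⋯ + b_{σ(k)} is nonzero. Then ∑_{σ ∈ S_n} sgn(σ) / (b_{σ(1)} (b_{σ(1)}+b_{σ(2)}) ⋯ (b_{σ(1)}+⋯+b_{σ(n)})) = 2ⁿ · ∏_{1≤i<j≤n} (bⱼ − bᵢ) / ∏_{1≤i≤j≤n} (bᵢ + bⱼ). -/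
open Finset

namespace PartialSums

variable {F : Type*} [Field F]

/-- Product over `j ≠ k` in terms of `succAbove`. -/
lemma prod_erase_succAbove {n : ℕ} (k : Fin (n + 1)) (f : Fin (n + 1) → F) :
    ∏ j ∈ univ.erase k, f j = ∏ i : Fin n, f (k.succAbove i) := by
  have h : (univ.erase k : Finset (Fin (n + 1))) = univ.image k.succAbove := by
    rw [Fin.image_succAbove_univ]; ext; simp
  rw [h, prod_image]
  intro a _ b _ hab
  exact Fin.succAbove_right_injective hab

/-- The Lagrange interpolation identity behind the induction step. -/
lemma lagrange_sum [CharZero F] {n : ℕ} (b : Fin (n + 1) → F) (hb : Function.Injective b) :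
    ∑ k, b k * ∏ i : Fin n, ((b k + b (k.succAbove i)) / (b k - b (k.succAbove i))) =
      ∑ k, b k := by
  classical
  let p : Polynomial F := ∏ i, (Polynomial.X - Polynomial.C (-b i))
  let q : Polynomial F := ∏ i, (Polynomial.X - Polynomial.C (b i))
  have hpm : p.Monic := Polynomial.monic_prod_of_monic _ _ fun i _ => Polynomial.monic_X_sub_C _
  have hqm : q.Monic := Polynomial.monic_prod_of_monic _ _ fun i _ => Polynomial.monic_X_sub_C _
  have hpd : p.degree = ((n + 1 : ℕ) : WithBot ℕ) := by
    simp [p, Polynomial.degree_prod]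
  have hqd : q.degree = ((n + 1 : ℕ) : WithBot ℕ) := by
    simp [q, Polynomial.degree_prod]
  have hd : (p - q).degree < #(univ : Finset (Fin (n + 1))) := by
    have := Polynomial.degree_sub_lt_left (hpd.trans hqd.symm) hpm.ne_zero
      (by rw [hpm.leadingCoeff, hqm.leadingCoeff])
    rw [hpd] at this
    simpa using this
  have key := Lagrange.coeff_eq_sum (s := univ) (v := b) hb.injOn hd
  have hp1 := Polynomial.prod_X_sub_C_coeff_card_pred univ (fun i => -b i) (by simp)
  have hq1 := Polynomial.prod_X_sub_C_coeff_card_pred univ b (by simp)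
  rw [Polynomial.coeff_sub] at key
  change p.coeff _ = _ at hp1
  change q.coeff _ = _ at hq1
  rw [hp1, hq1] at key
  have h2 : (2 : F) ≠ 0 := two_ne_zero
  apply mul_left_cancel₀ h2
  have e1 : (2 : F) * ∑ k, b k = -∑ i, -b i - -∑ i, b i := by
    rw [sum_neg_distrib]; ring
  rw [e1, key, mul_sum]
  refine sum_congr rfl fun k _ => ?_
  have hq0 : q.eval (b k) = 0 := by
    simp only [q, Polynomial.eval_prod]
    exact prod_eq_zero (mem_univ k) (by simp)
  have hp0 : p.eval (b k) = (b k + b k) * ∏ i : Fin n, (b k + b (k.succAbove i)) := by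
    simp only [p, Polynomial.eval_prod]
    rw [Fin.prod_univ_succAbove _ k]
    simp
  rw [Polynomial.eval_sub, hq0, hp0, prod_erase_succAbove, prod_div_distrib]
  ring

/-- Extend a permutation of `Fin n` to the one of `Fin (n+1)` sending `0` to `k`. -/
def ext {n : ℕ} (k : Fin (n + 1)) (τ : Equiv.Perm (Fin n)) : Equiv.Perm (Fin (n + 1)) :=
  k.cycleRange.symm * Equiv.Perm.decomposeFin.symm (0, τ)

lemma ext_zero {n : ℕ} (k : Fin (n + 1)) (τ : Equiv.Perm (Fin n)) : ext k τ 0 = k := by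
  simp [ext]

lemma ext_succ {n : ℕ} (k : Fin (n + 1)) (τ : Equiv.Perm (Fin n)) (i : Fin n) :
    ext k τ i.succ = k.succAbove (τ i) := by
  simp [ext]

lemma ext_sign {n : ℕ} (k : Fin (n + 1)) (τ : Equiv.Perm (Fin n)) :
    Equiv.Perm.sign (ext k τ) = (-1) ^ (k : ℕ) * Equiv.Perm.sign τ := by
  simp [ext, Equiv.Perm.sign_mul]

lemma ext_bijective (n : ℕ) :
    Function.Bijective (fun x : Fin (n + 1) × Equiv.Perm (Fin n) => ext x.1 x.2) := by
  rw [Fintype.bijective_iff_injective_and_card]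
  constructor
  · rintro ⟨k, τ⟩ ⟨k', τ'⟩ h
    simp only at h
    have hk : k = k' := by rw [← ext_zero k τ, h, ext_zero]
    subst hk
    refine Prod.ext rfl (Equiv.ext fun i => ?_)
    have := congrArg (fun e : Equiv.Perm (Fin (n + 1)) => e i.succ) h
    simp only [ext_succ] at this
    exact Fin.succAbove_right_injective this
  · simp [Fintype.card_perm, Nat.factorial_succ]

lemma sum_perm_succ {n : ℕ} (g : Equiv.Perm (Fin (n + 1)) → F) :
    ∑ σ, g σ = ∑ k, ∑ τ, g (ext k τ) := by
  rw [← Fintype.sum_prod_type' (f := fun k τ => g (ext k τ))]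
  exact ((ext_bijective n).sum_comp g).symm

/-- Product of the tail sums. -/
def Q {n : ℕ} (c : Fin n → F) : F := ∏ k, ∑ i ∈ univ.filter (fun i => k ≤ i), c i

lemma sum_tail_succ {n : ℕ} (c : Fin (n + 1) → F) (k : Fin n) :
    ∑ i ∈ univ.filter (fun i => k.succ ≤ i), c i =
      ∑ i ∈ univ.filter (fun i => k ≤ i), c i.succ := by
  simp only [sum_filter]
  rw [Fin.sum_univ_succ]
  simp

lemma Q_succ {n : ℕ} (c : Fin (n + 1) → F) : Q c = (∑ i, c i) * Q (fun i => c i.succ) := by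
  unfold Q
  rw [Fin.prod_univ_succ]
  simp only [sum_tail_succ]
  simp

/-- The signed sum. -/
def A {n : ℕ} (b : Fin n → F) : F :=
  ∑ σ : Equiv.Perm (Fin n), ((Equiv.Perm.sign σ : ℤ) : F) / Q (fun i => b (σ i))

lemma A_succ {n : ℕ} (b : Fin (n + 1) → F) :
    A b = (∑ k : Fin (n + 1), (-1) ^ (k : ℕ) * A (fun i => b (k.succAbove i))) / ∑ i, b i := by
  unfold A
  rw [sum_perm_succ, sum_div]
  refine sum_congr rfl fun k _ => ?_
  rw [mul_sum, sum_div]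
  refine sum_congr rfl fun τ _ => ?_
  rw [Q_succ, Equiv.sum_comp (ext k τ) b]
  simp only [ext_succ, ext_sign]
  push_cast
  rw [mul_comm (∑ i, b i), ← div_div]
  congr 1
  rw [mul_div_assoc]

lemma A_comp {n : ℕ} (b : Fin n → F) (π : Equiv.Perm (Fin n)) :
    A b = ((Equiv.Perm.sign π : ℤ) : F) * A (fun i => b (π i)) := by
  unfold A
  rw [mul_sum, ← Equiv.sum_comp (Equiv.mulLeft π)]
  refine sum_congr rfl fun σ _ => ?_
  simp [Equiv.Perm.sign_mul, mul_div_assoc]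

lemma A_eq_zero [CharZero F] {n : ℕ} (b : Fin n → F) {i j : Fin n} (hij : i ≠ j)
    (h : b i = b j) : A b = 0 := by
  have h1 := A_comp b (Equiv.swap i j)
  have h2 : (fun x => b (Equiv.swap i j x)) = b := by
    funext x
    rcases eq_or_ne x i with rfl | hi
    · simp [h]
    rcases eq_or_ne x j with rfl | hj
    · simp [h]
    rw [Equiv.swap_apply_of_ne_of_ne hi hj]
  rw [h2, Equiv.Perm.sign_swap hij] at h1
  push_cast at h1
  have : (2 : F) * A b = 0 := by linear_combination h1
  simpa using this

/-- `∏_{i<j} (b i - b j)`. -/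
def D {n : ℕ} (b : Fin n → F) : F := ∏ i, ∏ j ∈ Ioi i, (b i - b j)

/-- `∏_{i<j} (b i + b j)`. -/
def E {n : ℕ} (b : Fin n → F) : F := ∏ i, ∏ j ∈ Ioi i, (b i + b j)

lemma D_comp {n : ℕ} (b : Fin n → F) (π : Equiv.Perm (Fin n)) :
    D (fun i => b (π i)) = ((Equiv.Perm.sign π : ℤ) : F) * D b := by
  have h (c : Fin n → F) : D c = (Matrix.vandermonde fun i => -c i).det := by
    rw [Matrix.det_vandermonde]
    unfold D
    refine prod_congr rfl fun i _ => prod_congr rfl fun j _ => by ring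
  rw [h, h, ← Matrix.det_permute]
  rfl

lemma D_mul_E {n : ℕ} (b : Fin n → F) : D b * E b = D (fun i => b i ^ 2) := by
  unfold D E
  rw [← prod_mul_distrib]
  refine prod_congr rfl fun i _ => ?_
  rw [← prod_mul_distrib]
  refine prod_congr rfl fun j _ => by ring

lemma D_ne_zero {n : ℕ} (b : Fin n → F) (hb : Function.Injective b) : D b ≠ 0 := by
  unfold D
  refine prod_ne_zero_iff.2 fun i _ => prod_ne_zero_iff.2 fun j hj => ?_
  rw [sub_ne_zero]
  intro h
  have := hb h
  subst this
  simp at hj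

lemma E_comp {n : ℕ} (b : Fin n → F) (hb : Function.Injective b) (π : Equiv.Perm (Fin n)) :
    E (fun i => b (π i)) = E b := by
  have h0 : D (fun i => b (π i)) ≠ 0 := D_ne_zero _ (hb.comp π.injective)
  apply mul_left_cancel₀ h0
  rw [D_mul_E, D_comp (fun i => b i ^ 2), ← D_mul_E, D_comp]
  ring

lemma D_succ {n : ℕ} (b : Fin (n + 1) → F) :
    D b = (∏ i : Fin n, (b 0 - b i.succ)) * D (fun i => b i.succ) := by
  unfold D
  simp [Fin.prod_univ_succ, Fin.prod_Ioi_zero, Fin.prod_Ioi_succ]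

lemma E_succ {n : ℕ} (b : Fin (n + 1) → F) :
    E b = (∏ i : Fin n, (b 0 + b i.succ)) * E (fun i => b i.succ) := by
  unfold E
  simp [Fin.prod_univ_succ, Fin.prod_Ioi_zero, Fin.prod_Ioi_succ]

lemma E_ne_zero {n : ℕ} (b : Fin n → F) (h : ∀ i j, b i + b j ≠ 0) : E b ≠ 0 :=
  prod_ne_zero_iff.2 fun i _ => prod_ne_zero_iff.2 fun j _ => h i j

theorem main [CharZero F] {n : ℕ} (b : Fin n → F) (h : ∀ i j, b i + b j ≠ 0)
    (hps : ∀ σ : Equiv.Perm (Fin n), ∀ k : Fin n,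
      (∑ i ∈ univ.filter (fun i : Fin n => k ≤ i), b (σ i)) ≠ 0) :
    A b = D b / (E b * ∏ i, b i) := by
  induction n with
  | zero => simp [A, D, E, Q]
  | succ n ih =>
    by_cases hb : Function.Injective b
    swap
    · simp only [Function.Injective, not_forall] at hb
      obtain ⟨i, j, hij, hne⟩ := hb
      rw [A_eq_zero b hne hij]
      have : D b = 0 := by
        unfold D
        rcases lt_or_gt_of_ne hne with hlt | hlt
        · exact prod_eq_zero (mem_univ i) (prod_eq_zero (mem_Ioi.2 hlt) (by rw [hij, sub_self]))
        · exact prod_eq_zero (mem_univ j) (prod_eq_zero (mem_Ioi.2 hlt) (by rw [hij, sub_self]))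
      rw [this, zero_div]
    have hb0 : ∀ i, b i ≠ 0 := fun i h0 => h i i (by rw [h0, add_zero])
    have hS : ∑ i, b i ≠ 0 := by
      have := hps 1 0
      simpa using this
    rw [A_succ, div_eq_iff hS, ← lagrange_sum b hb, mul_sum]
    refine sum_congr rfl fun k _ => ?_
    rw [ih (fun i => b (k.succAbove i)) (fun i j => h _ _)]
    swap
    · intro τ j
      have := hps (ext k τ) j.succ
      rw [sum_tail_succ (fun i => b (ext k τ i))] at this
      simpa only [ext_succ] using this
    have hD := D_comp b k.cycleRange.symm
    have hE := E_comp b hb k.cycleRange.symm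
    rw [D_succ] at hD
    rw [E_succ] at hE
    simp only [Fin.cycleRange_symm_zero, Fin.cycleRange_symm_succ, Equiv.Perm.sign_symm,
      Fin.sign_cycleRange] at hD hE
    push_cast at hD
    have n1 : E (fun i => b (k.succAbove i)) ≠ 0 := E_ne_zero _ fun i j => h _ _
    have n2 : ∏ i, b (k.succAbove i) ≠ 0 := prod_ne_zero_iff.2 fun i _ => hb0 _
    have n3 : ∏ i : Fin n, (b k + b (k.succAbove i)) ≠ 0 := prod_ne_zero_iff.2 fun i _ => h _ _
    have n4 : ∏ i : Fin n, (b k - b (k.succAbove i)) ≠ 0 := prod_ne_zero_iff.2 fun i _ =>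
      sub_ne_zero.2 fun e => Fin.succAbove_ne k i (hb e).symm
    have n5 := hb0 k
    have hs : ((-1 : F) ^ (k : ℕ)) * (-1) ^ (k : ℕ) = 1 := by
      rw [← mul_pow]; simp
    have hD' : D b = (-1) ^ (k : ℕ) * ((∏ i : Fin n, (b k - b (k.succAbove i))) *
        D fun i => b (k.succAbove i)) := by
      rw [hD, ← mul_assoc, hs, one_mul]
    rw [Fin.prod_univ_succAbove b k, ← hE, hD', prod_div_distrib]
    field_simp

end PartialSums

/-- Closed form for the signed sum `∑_σ sgn(σ)/∏ₖ (b_{σ(1)}+⋯+b_{σ(k)})` in a field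
of characteristic zero. -/
theorem stmt_5 (F : Type*) [Field F] [CharZero F] (n : ℕ) (hn : 1 ≤ n)
    (b : Fin n → F)
    (hbij : ∀ i j : Fin n, i ≤ j → b i + b j ≠ 0)
    (hps : ∀ σ : Equiv.Perm (Fin n), ∀ k : Fin n,
      (∑ i ∈ Finset.univ.filter (fun i : Fin n => i ≤ k), b (σ i)) ≠ 0) :
    (∑ σ : Equiv.Perm (Fin n),
        ((Equiv.Perm.sign σ : ℤ) : F) /
          ∏ k : Fin n, ∑ i ∈ Finset.univ.filter (fun i : Fin n => i ≤ k), b (σ i)) =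
      2 ^ n *
        (∏ p ∈ Finset.univ.filter (fun p : Fin n × Fin n => p.1 < p.2),
            (b p.2 - b p.1)) /
          ∏ p ∈ Finset.univ.filter (fun p : Fin n × Fin n => p.1 ≤ p.2),
            (b p.1 + b p.2) := by
  have h : ∀ i j, b i + b j ≠ 0 := fun i j => by
    rcases le_total i j with hij | hij
    · exact hbij i j hij
    · rw [add_comm]; exact hbij j i hij
  -- reversal of the order
  have hrev (c : Fin n → F) (k : Fin n) :
      ∑ i ∈ univ.filter (fun i : Fin n => i ≤ k), c i =
        ∑ i ∈ univ.filter (fun i : Fin n => k.rev ≤ i), c i.rev := by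
    simp only [sum_filter]
    rw [← Equiv.sum_comp Fin.revPerm]
    refine sum_congr rfl fun i _ => ?_
    simp [Fin.rev_le_iff]
  have hmain := PartialSums.main (fun i => b i.rev) (fun i j => h _ _) (by
    intro σ k
    have := hps (Fin.revPerm * σ * Fin.revPerm) k.rev
    rw [hrev] at this
    simpa using this)
  have hL : (∑ σ : Equiv.Perm (Fin n), ((Equiv.Perm.sign σ : ℤ) : F) /
      ∏ k : Fin n, ∑ i ∈ Finset.univ.filter (fun i : Fin n => i ≤ k), b (σ i)) =
      PartialSums.A (fun i => b i.rev) := by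
    unfold PartialSums.A PartialSums.Q
    rw [← Equiv.sum_comp (MulAut.conj (Fin.revPerm : Equiv.Perm (Fin n))).toEquiv]
    refine sum_congr rfl fun σ _ => ?_
    have hsg : Equiv.Perm.sign ((MulAut.conj (Fin.revPerm : Equiv.Perm (Fin n))).toEquiv σ) =
        Equiv.Perm.sign σ := by
      change Equiv.Perm.sign (Fin.revPerm * σ * Fin.revPerm⁻¹) = _
      rw [Equiv.Perm.sign_mul, Equiv.Perm.sign_mul, Equiv.Perm.sign_inv, mul_right_comm,
        Int.units_mul_self, one_mul]
    rw [hsg]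
    congr 1
    · rw [← Equiv.prod_comp Fin.revPerm]
      refine prod_congr rfl fun k _ => ?_
      rw [hrev]
      have hr : (Fin.revPerm : Equiv.Perm (Fin n))⁻¹ = Fin.revPerm := rfl
      simp [MulAut.conj_apply, hr]
  have hpair (f : Fin n → Fin n → F) :
      ∏ p ∈ univ.filter (fun p : Fin n × Fin n => p.1 < p.2), f p.1 p.2 =
        ∏ i : Fin n, ∏ j ∈ Ioi i, f j.rev i.rev := by
    rw [prod_sigma']
    refine prod_bij' (fun p _ => ⟨p.2.rev, p.1.rev⟩) (fun x _ => (x.2.rev, x.1.rev))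
      ?_ ?_ ?_ ?_ ?_ <;> simp
  have hD : ∏ p ∈ univ.filter (fun p : Fin n × Fin n => p.1 < p.2), (b p.2 - b p.1) =
      PartialSums.D (fun i => b i.rev) := hpair fun i j => b j - b i
  have hE : ∏ p ∈ univ.filter (fun p : Fin n × Fin n => p.1 < p.2), (b p.1 + b p.2) =
      PartialSums.E (fun i => b i.rev) := by
    rw [hpair fun i j => b i + b j]
    unfold PartialSums.E
    exact prod_congr rfl fun i _ => prod_congr rfl fun j _ => add_comm _ _
  have hdiag : ∏ p ∈ univ.filter (fun p : Fin n × Fin n => p.1 = p.2), (b p.1 + b p.2) =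
      2 ^ n * ∏ i : Fin n, b i.rev := by
    have e1 : ∏ i : Fin n, b i.rev = ∏ i, b i := Equiv.prod_comp Fin.revPerm b
    have e2 : ∏ p ∈ univ.filter (fun p : Fin n × Fin n => p.1 = p.2), (b p.1 + b p.2) =
        ∏ i : Fin n, (2 * b i) := by
      refine prod_bij' (fun p _ => p.1) (fun x _ => (x, x)) ?_ ?_ ?_ ?_ ?_
      · simp
      · simp
      · rintro ⟨x, y⟩ hxy
        simpa using hxy
      · simp
      · rintro ⟨x, y⟩ hxy
        have : x = y := by simpa using hxy
        subst this
        exact (two_mul _).symm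
    rw [e1, e2, prod_mul_distrib]
    simp
  have hle : ∏ p ∈ univ.filter (fun p : Fin n × Fin n => p.1 ≤ p.2), (b p.1 + b p.2) =
      PartialSums.E (fun i => b i.rev) * (2 ^ n * ∏ i : Fin n, b i.rev) := by
    rw [← hE, ← hdiag, ← prod_union]
    · congr 1
      ext p
      simp [le_iff_lt_or_eq]
    · rw [disjoint_filter]
      intro p _ h1 h2
      exact h1.ne h2
  rw [hL, hmain, hD, hle, mul_left_comm, mul_div_mul_left]
  exact pow_ne_zero _ two_ne_zero
end

section
/- Let n ≥ 1 and let κ be a real number. Consider the function on [4,∞)ⁿ given by u = (u₁,…,uₙ) ↦ ∏_{d=1}^{n} u_d^{−κ/2} · ∏_{1≤i<j≤n} |uᵢ − uⱼ|. This function is integrable on [4,∞)ⁿ (with respect to Lebesgue measure) if and only if κ > 2n, and when κ > 2n one has 2^{nκ−n} · ∫_{[4,∞)ⁿ} ∏_{d=1}^{n} u_d^{−κ/2} ∏_{1≤i<j≤n} |uᵢ − uⱼ| du₁⋯duₙ = 2^{n(n+1)} · ∏_{j=1}^{n} j! / ∏_{1≤i≤j≤n} (κ − (i+j)). -/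
open MeasureTheory Finset
lemma lag {m : ℕ} (s : Fin (m+1) → ℝ) (hs : Function.Injective s) (hpos : ∀ i, 0 < s i) :
    ∑ j, s j * ∏ i : Fin m, ((s j + s (j.succAbove i)) / (s j - s (j.succAbove i))) = ∑ j, s j := by
  classical
  set P : Polynomial ℝ := ∏ i, (Polynomial.X - Polynomial.C (-s i)) -
    ∏ i, (Polynomial.X - Polynomial.C (s i)) with hP
  have m1 : (∏ i, (Polynomial.X - Polynomial.C (-s i))).Monic :=
    Polynomial.monic_prod_of_monic _ _ (fun i _ => Polynomial.monic_X_sub_C _)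
  have m2 : (∏ i, (Polynomial.X - Polynomial.C (s i))).Monic :=
    Polynomial.monic_prod_of_monic _ _ (fun i _ => Polynomial.monic_X_sub_C _)
  have d1 : (∏ i, (Polynomial.X - Polynomial.C (-s i))).degree = ((m+1 : ℕ) : WithBot ℕ) := by
    rw [Polynomial.degree_prod]; simp
  have d2 : (∏ i, (Polynomial.X - Polynomial.C (s i))).degree = ((m+1 : ℕ) : WithBot ℕ) := by
    rw [Polynomial.degree_prod]; simp
  have hd : P.degree < ((#(univ : Finset (Fin (m+1))) : ℕ) : WithBot ℕ) := by
    rw [card_univ, Fintype.card_fin, ← d1]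
    apply Polynomial.degree_sub_lt_left (by rw [d1, d2]) m1.ne_zero
    rw [m1.leadingCoeff, m2.leadingCoeff]
  have key := Lagrange.coeff_eq_sum (s := univ) (v := s) hs.injOn hd
  have c1 : P.coeff (#(univ : Finset (Fin (m+1))) - 1) = 2 * ∑ j, s j := by
    rw [hP, Polynomial.coeff_sub, Polynomial.prod_X_sub_C_coeff_card_pred _ _ (by simp),
      Polynomial.prod_X_sub_C_coeff_card_pred _ _ (by simp)]
    simp; ring
  rw [c1] at key
  have : ∀ j, Polynomial.eval (s j) P / ∏ i ∈ univ.erase j, (s j - s i) =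
      2 * (s j * ∏ i : Fin m, ((s j + s (j.succAbove i)) / (s j - s (j.succAbove i)))) := by
    intro j
    have e1 : Polynomial.eval (s j) P = 2 * s j * ∏ i : Fin m, (s j + s (j.succAbove i)) := by
      rw [hP, Polynomial.eval_sub, Polynomial.eval_prod, Polynomial.eval_prod,
        Fin.prod_univ_succAbove _ j, Fin.prod_univ_succAbove (fun i => Polynomial.eval (s j) (Polynomial.X - Polynomial.C (s i))) j]
      simp
      left; ring
    have e2 : ∏ i ∈ univ.erase j, (s j - s i) = ∏ i : Fin m, (s j - s (j.succAbove i)) := by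
      rw [← Finset.compl_singleton, ← Fin.image_succAbove_univ, prod_image]
      intro a _ b _ h
      exact Fin.succAbove_right_injective h
    rw [e1, e2, prod_div_distrib]; ring
  simp_rw [this] at key
  rw [← mul_sum] at key
  linarith

lemma pairs_succAbove {m : ℕ} (f : Fin (m+1) → Fin (m+1) → ℝ) (j : Fin (m+1))
    (hf : ∀ i k, i ≠ k → f i k = - f k i) :
    (∏ i, ∏ k, if i < k then f i k else 1) =
      (-1) ^ (j : ℕ) * (∏ i : Fin m, f j (j.succAbove i)) *
      ∏ i : Fin m, ∏ k : Fin m, if i < k then f (j.succAbove i) (j.succAbove k) else 1 := by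
  have hsgn : (-1 : ℝ) ^ (j : ℕ) = ∏ i : Fin m, (if j.succAbove i < j then (-1 : ℝ) else 1) := by
    have h := Fin.prod_univ_succAbove (fun i => if i < j then (-1 : ℝ) else 1) j
    simp only [lt_irrefl, if_false, one_mul] at h
    rw [← h, prod_ite, prod_const, prod_const_one, mul_one]
    congr 1
    have : (univ.filter fun x => x < j) = Iio j := by ext; simp
    rw [this]; simp
  simp only [fun g : Fin (m+1) → ℝ => Fin.prod_univ_succAbove g j]
  simp only [lt_irrefl, if_false, one_mul, Fin.succAbove_lt_succAbove_iff, prod_mul_distrib]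
  have hrow : (∏ i : Fin m, if j < j.succAbove i then f j (j.succAbove i) else 1) *
      (∏ i : Fin m, if j.succAbove i < j then f (j.succAbove i) j else 1) =
      (-1) ^ (j : ℕ) * (∏ i : Fin m, f j (j.succAbove i)) := by
    rw [hsgn, ← prod_mul_distrib, ← prod_mul_distrib]
    refine prod_congr rfl fun i _ => ?_
    rcases lt_trichotomy (j.succAbove i) j with h | h | h
    · rw [if_neg h.not_gt, if_pos h, if_pos h, hf _ _ h.ne]; ring
    · exact absurd h (Fin.succAbove_ne j i)
    · rw [if_pos h, if_neg h.not_gt, if_neg h.not_gt]; ring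
  rw [← mul_assoc, hrow]

noncomputable def FF {n : ℕ} (s : Fin n → ℝ) : ℝ :=
  (∏ j, (s j)⁻¹) * ∏ i, ∏ k, if i < k then (s i - s k) / (s i + s k) else 1

lemma FF_rec {m : ℕ} (s : Fin (m+1) → ℝ) (hs : Function.Injective s) (hpos : ∀ i, 0 < s i) :
    ∑ j : Fin (m+1), (-1) ^ (j : ℕ) * FF (fun i => s (j.succAbove i)) = (∑ j, s j) * FF s := by
  rw [← lag s hs hpos, sum_mul]
  refine sum_congr rfl fun j _ => ?_
  unfold FF
  rw [pairs_succAbove (fun i k => (s i - s k) / (s i + s k)) j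
    (fun i k _ => by rw [← neg_div, neg_sub, add_comm]), Fin.prod_univ_succAbove (fun j => (s j)⁻¹) j]
  have h1 : s j * (s j)⁻¹ = 1 := mul_inv_cancel₀ (hpos j).ne'
  have h2 : (∏ i : Fin m, ((s j + s (j.succAbove i)) / (s j - s (j.succAbove i)))) *
      (∏ i : Fin m, ((s j - s (j.succAbove i)) / (s j + s (j.succAbove i)))) = 1 := by
    rw [← prod_mul_distrib]
    refine prod_eq_one fun i _ => ?_
    have : s j - s (j.succAbove i) ≠ 0 := sub_ne_zero.2 fun h => Fin.succAbove_ne j i (hs h).symm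
    have := hpos j
    have := hpos (j.succAbove i)
    field_simp
  linear_combination (-(-1) ^ (j : ℕ) * ((∏ i : Fin m, (s (j.succAbove i))⁻¹) * ∏ i : Fin m, ∏ k : Fin m, if i < k then (s (j.succAbove i) - s (j.succAbove k)) / (s (j.succAbove i) + s (j.succAbove k)) else 1)) * h1 * ((∏ i : Fin m, ((s j + s (j.succAbove i)) / (s j - s (j.succAbove i)))) *
      (∏ i : Fin m, ((s j - s (j.succAbove i)) / (s j + s (j.succAbove i))))) - ((-1) ^ (j : ℕ) * ((∏ i : Fin m, (s (j.succAbove i))⁻¹) * ∏ i : Fin m, ∏ k : Fin m, if i < k then (s (j.succAbove i) - s (j.succAbove k)) / (s (j.succAbove i) + s (j.succAbove k)) else 1)) * h2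

noncomputable def DD {n : ℕ} (s : Fin n → ℝ) (u : Fin n → ℝ) : ℝ :=
  (Matrix.of fun i j => u i ^ (-s j - 1)).det

def SS (n : ℕ) (T : ℝ) : Set (Fin n → ℝ) := {u | (∀ i, T < u i) ∧ StrictMono u}

lemma measurableSet_SM (n : ℕ) : MeasurableSet {u : Fin n → ℝ | StrictMono u} := by
  have : {u : Fin n → ℝ | StrictMono u} = ⋂ i, ⋂ j, ⋂ (_ : i < j), {u | u i < u j} := by
    ext u; simp [StrictMono]
  rw [this]
  refine MeasurableSet.iInter fun i => MeasurableSet.iInter fun j => MeasurableSet.iInter fun _ => ?_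
  exact measurableSet_lt (measurable_pi_apply i) (measurable_pi_apply j)

lemma box_eq (n : ℕ) (T : ℝ) : {u : Fin n → ℝ | ∀ i, T < u i} = Set.univ.pi fun _ => Set.Ioi T := by
  ext u; simp

lemma measurableSet_SS (n : ℕ) (T : ℝ) : MeasurableSet (SS n T) := by
  have : SS n T = {u : Fin n → ℝ | ∀ i, T < u i} ∩ {u | StrictMono u} := rfl
  rw [this, box_eq]
  exact (MeasurableSet.univ_pi fun _ => measurableSet_Ioi).inter (measurableSet_SM n)

lemma DD_integrable {n : ℕ} (s : Fin n → ℝ) (hpos : ∀ i, 0 < s i) {T : ℝ} (hT : 0 < T) :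
    IntegrableOn (DD s) {u | ∀ i, T < u i} volume := by
  rw [box_eq, IntegrableOn, volume_pi, Measure.restrict_pi_pi]
  have : DD s = fun u : Fin n → ℝ => ∑ σ : Equiv.Perm (Fin n),
      ((Equiv.Perm.sign σ : ℤ) : ℝ) * ∏ i, u i ^ (-s (σ i) - 1) := by
    ext u
    rw [DD, ← Matrix.det_transpose, Matrix.det_apply']
    rfl
  rw [this]
  refine integrable_finsetSum _ fun σ _ => Integrable.const_mul ?_ _
  refine Integrable.fintype_prod (f := fun i x => x ^ (-s (σ i) - 1)) fun i => ?_
  exact (integrableOn_Ioi_rpow_iff hT).2 (by have := hpos (σ i); linarith)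

lemma DD_integrable' {n : ℕ} (s : Fin n → ℝ) (hpos : ∀ i, 0 < s i) {T : ℝ} (hT : 0 < T) :
    IntegrableOn (DD s) (SS n T) volume :=
  (DD_integrable s hpos hT).mono_set fun _ h => h.1

lemma cons_mem_SS {n : ℕ} {T x : ℝ} {y : Fin n → ℝ} :
    (Fin.cons x y : Fin (n+1) → ℝ) ∈ SS (n+1) T ↔ T < x ∧ y ∈ SS n x := by
  unfold SS
  constructor
  · rintro ⟨h1, h2⟩
    refine ⟨by simpa using h1 0, fun i => ?_, fun i j hij => ?_⟩
    · simpa using h2 (Fin.succ_pos i)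
    · simpa using h2 (Fin.succ_lt_succ_iff.2 hij)
  · rintro ⟨h1, h2, h3⟩
    refine ⟨fun i => ?_, fun i j hij => ?_⟩
    · refine Fin.cases (by simpa using h1) (fun i => ?_) i
      simpa using h1.trans (h2 i)
    · revert hij
      refine Fin.cases ?_ (fun j => ?_) j
      · intro h; exact absurd h (Fin.not_lt_zero i)
      · refine Fin.cases ?_ (fun i => ?_) i
        · intro _; simpa using h2 j
        · intro h; simpa using h3 (Fin.succ_lt_succ_iff.1 h)

lemma DD_cons {n : ℕ} (s : Fin (n+1) → ℝ) (x : ℝ) (y : Fin n → ℝ) :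
    DD s (Fin.cons x y) = ∑ j : Fin (n+1), ((-1) ^ (j : ℕ) * x ^ (-s j - 1)) *
      DD (fun i => s (j.succAbove i)) y := by
  rw [DD, Matrix.det_succ_row_zero]
  refine sum_congr rfl fun j _ => ?_
  rfl

lemma mp_cons (n : ℕ) : MeasurePreserving
    (MeasurableEquiv.piFinSuccAbove (fun _ : Fin (n+1) => ℝ) 0).symm volume volume :=
  (volume_preserving_piFinSuccAbove (fun _ : Fin (n+1) => ℝ) 0).symm _

lemma cons_apply (n : ℕ) (p : ℝ × (Fin n → ℝ)) :
    (MeasurableEquiv.piFinSuccAbove (fun _ : Fin (n+1) => ℝ) 0).symm p = Fin.cons p.1 p.2 := by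
  rw [MeasurableEquiv.piFinSuccAbove_symm_apply]
  simp [Fin.insertNthEquiv]

theorem main_int : ∀ (n : ℕ) (s : Fin n → ℝ), Function.Injective s → (∀ i, 0 < s i) →
    ∀ T : ℝ, 0 < T → ∫ u in SS n T, DD s u = T ^ (-∑ j, s j) * FF s := by
  intro n
  induction n with
  | zero =>
    intro s _ _ T hT
    have : SS 0 T = Set.univ := by
      ext u; simp [SS, Subsingleton.strictMono]
    rw [this]
    rw [volume_pi, Measure.pi_of_empty _ (fun i => i.elim0)]
    simp [DD, FF]
  | succ n ih =>
    intro s hs hpos T hT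
    have hint := (integrable_indicator_iff (measurableSet_SS (n+1) T)).2 (DD_integrable' s hpos hT)
    have hint2 := ((mp_cons n).integrable_comp_emb (MeasurableEquiv.measurableEmbedding _)).2 hint
    rw [← integral_indicator (measurableSet_SS _ _), ← (mp_cons n).integral_comp', Measure.volume_eq_prod]
    refine (integral_prod _ hint2).trans ?_
    have hS : 0 < ∑ j, s j := sum_pos (fun i _ => hpos i) univ_nonempty
    have inner : ∀ x : ℝ, (∫ y, (SS (n+1) T).indicator (DD s)
        ((MeasurableEquiv.piFinSuccAbove (fun _ : Fin (n+1) => ℝ) 0).symm (x, y))) =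
        (Set.Ioi T).indicator (fun x => x ^ (-(∑ j, s j) - 1) * ((∑ j, s j) * FF s)) x := by
      intro x
      by_cases hx : T < x
      · rw [Set.indicator_of_mem (show x ∈ Set.Ioi T from hx)]
        have hx0 := hT.trans hx
        have e : ∀ y, (SS (n+1) T).indicator (DD s)
            ((MeasurableEquiv.piFinSuccAbove (fun _ : Fin (n+1) => ℝ) 0).symm (x, y)) =
            (SS n x).indicator (fun y => ∑ j : Fin (n+1), ((-1) ^ (j : ℕ) * x ^ (-s j - 1)) *
              DD (fun i => s (j.succAbove i)) y) y := by
          intro y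
          rw [cons_apply]
          by_cases hy : y ∈ SS n x
          · rw [Set.indicator_of_mem hy, Set.indicator_of_mem (cons_mem_SS.2 ⟨hx, hy⟩), DD_cons]
          · rw [Set.indicator_of_notMem hy, Set.indicator_of_notMem (fun h => hy (cons_mem_SS.1 h).2)]
        simp_rw [e]
        rw [integral_indicator (measurableSet_SS _ _), integral_finsetSum _ (fun j _ =>
          (DD_integrable' (fun i => s (j.succAbove i)) (fun i => hpos _) hx0).const_mul _)]
        rw [← FF_rec s hs hpos, mul_sum]
        refine sum_congr rfl fun j _ => ?_
        rw [integral_const_mul, ih (fun i => s (j.succAbove i)) (hs.comp Fin.succAbove_right_injective) (fun i => hpos _) x hx0]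
        have : x ^ (-(∑ j, s j) - 1) = x ^ (-s j - 1) * x ^ (-∑ i, s (j.succAbove i)) := by
          rw [← Real.rpow_add hx0, Fin.sum_univ_succAbove _ j]
          congr 1; ring
        rw [this]; ring
      · rw [Set.indicator_of_notMem (show x ∉ Set.Ioi T from hx)]
        have e : ∀ y, (SS (n+1) T).indicator (DD s)
            ((MeasurableEquiv.piFinSuccAbove (fun _ : Fin (n+1) => ℝ) 0).symm (x, y)) = 0 := by
          intro y
          rw [cons_apply, Set.indicator_of_notMem (fun h => hx (cons_mem_SS.1 h).1)]
        simp only [e, integral_zero]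
    simp only [Function.comp_apply] 
    simp_rw [inner]
    rw [integral_indicator measurableSet_Ioi, integral_mul_const, integral_Ioi_rpow_of_lt (by linarith) hT]
    rw [show -(∑ j, s j) - 1 + 1 = -(∑ j, s j) by ring]
    field_simp

lemma absprod {n : ℕ} (u : Fin n → ℝ) :
    ∏ q ∈ Finset.univ.filter (fun q : Fin n × Fin n => q.1 < q.2), |u q.1 - u q.2| =
      |∏ i, ∏ j ∈ Ioi i, (u j - u i)| := by
  rw [abs_prod, prod_filter, Fintype.prod_prod_type]
  refine prod_congr rfl fun i _ => ?_
  rw [abs_prod, ← Finset.filter_lt_eq_Ioi, prod_filter]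
  refine prod_congr rfl fun j _ => ?_
  simp only [abs_sub_comm]

noncomputable def sk (n : ℕ) (κ : ℝ) : Fin n → ℝ := fun j => κ / 2 - ((j : ℕ) + 1)

lemma DD_sk {n : ℕ} (κ : ℝ) (u : Fin n → ℝ) (hu : ∀ i, 0 < u i) :
    DD (sk n κ) u = (∏ d : Fin n, u d ^ (-(κ / 2))) * ∏ i, ∏ j ∈ Ioi i, (u j - u i) := by
  rw [← Matrix.det_vandermonde, ← Matrix.det_mul_column, DD]
  congr 1
  ext i j
  simp only [Matrix.of_apply, Matrix.vandermonde_apply, sk]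
  rw [← Real.rpow_natCast, ← Real.rpow_add (hu i)]
  congr 1; ring

lemma f_eq {n : ℕ} (κ : ℝ) (u : Fin n → ℝ) (hu : ∀ i, 0 < u i) :
    (∏ d : Fin n, u d ^ (-(κ / 2))) *
            ∏ q ∈ Finset.univ.filter (fun q : Fin n × Fin n => q.1 < q.2),
              |u q.1 - u q.2| = |DD (sk n κ) u| := by
  rw [DD_sk κ u hu, absprod, abs_mul, abs_of_nonneg (prod_nonneg fun i _ => (Real.rpow_pos_of_pos (hu i) _).le)]

lemma DD_nonneg {n : ℕ} (κ : ℝ) (u : Fin n → ℝ) (hu : ∀ i, 0 < u i) (hm : StrictMono u) :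
    0 ≤ DD (sk n κ) u := by
  rw [DD_sk κ u hu]
  refine mul_nonneg (prod_nonneg fun i _ => (Real.rpow_pos_of_pos (hu i) _).le) ?_
  refine prod_nonneg fun i _ => prod_nonneg fun j hj => ?_
  exact sub_nonneg.2 (hm (mem_Ioi.1 hj)).le

lemma absDD_perm {n : ℕ} (s u : Fin n → ℝ) (σ : Equiv.Perm (Fin n)) :
    |DD s (fun i => u (σ i))| = |DD s u| := by
  have : DD s (fun i => u (σ i)) = ((Equiv.Perm.sign σ : ℤ) : ℝ) * DD s u := by
    rw [DD, DD, ← Matrix.det_permute]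
    rfl
  rw [this, abs_mul]
  rcases Int.units_eq_one_or (Equiv.Perm.sign σ) with h | h <;> simp [h]

lemma ae_inj (n : ℕ) : ∀ᵐ u : Fin n → ℝ, Function.Injective u := by
  have : ∀ i j : Fin n, ∀ᵐ u : Fin n → ℝ, u i = u j → i = j := by
    intro i j
    by_cases hij : i = j
    · simp [hij]
    let L : (Fin n → ℝ) →ₗ[ℝ] ℝ := (LinearMap.proj i : (Fin n → ℝ) →ₗ[ℝ] ℝ) - LinearMap.proj j
    have h := Measure.addHaar_submodule (volume : Measure (Fin n → ℝ)) (LinearMap.ker L) (by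
      intro h
      have : Pi.single i (1:ℝ) ∈ LinearMap.ker L := by rw [h]; trivial
      rw [LinearMap.mem_ker] at this
      simp [L, hij, Pi.single_apply, Ne.symm hij] at this)
    rw [ae_iff]
    convert h using 2
    ext u
    simp [L, hij, sub_eq_zero]
  filter_upwards [ae_all_iff.2 fun i => ae_all_iff.2 (this i)] with u hu i j h
  exact hu i j h

lemma mp_perm {n : ℕ} (σ : Equiv.Perm (Fin n)) :
    MeasurePreserving (MeasurableEquiv.piCongrLeft (fun _ : Fin n => ℝ) σ.symm) volume volume :=
  volume_measurePreserving_piCongrLeft (fun _ : Fin n => ℝ) σ.symm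

lemma perm_apply {n : ℕ} (σ : Equiv.Perm (Fin n)) (u : Fin n → ℝ) :
    MeasurableEquiv.piCongrLeft (fun _ : Fin n => ℝ) σ.symm u = fun i => u (σ i) := by
  ext i
  have := MeasurableEquiv.piCongrLeft_apply_apply σ.symm (β := fun _ => ℝ) u (σ i)
  simpa using this

lemma sym_int {n : ℕ} (g : (Fin n → ℝ) → ℝ) (hg : ∀ u (σ : Equiv.Perm (Fin n)), g (fun i => u (σ i)) = g u)
    (T : ℝ) (hi : IntegrableOn g (SS n T)) :
    ∫ u in {u | ∀ i, T < u i}, g u = (n.factorial : ℝ) * ∫ u in SS n T, g u := by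
  have hi' := (integrable_indicator_iff (measurableSet_SS n T)).2 hi
  rw [← integral_indicator (by rw [box_eq]; exact MeasurableSet.univ_pi fun _ => measurableSet_Ioi),
    ← integral_indicator (measurableSet_SS n T)]
  have hσ : ∀ σ : Equiv.Perm (Fin n), ∫ u : Fin n → ℝ, (SS n T).indicator g (fun i => u (σ i)) =
      ∫ u, (SS n T).indicator g u := by
    intro σ
    have := (mp_perm σ).integral_comp' ((SS n T).indicator g)
    simpa only [perm_apply] using this
  have hσi : ∀ σ : Equiv.Perm (Fin n), Integrable fun u : Fin n → ℝ => (SS n T).indicator g (fun i => u (σ i)) := by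
    intro σ
    have := ((mp_perm σ).integrable_comp_emb (MeasurableEquiv.measurableEmbedding _)).2 hi'
    refine this.congr (Filter.Eventually.of_forall fun u => ?_)
    simp only [Function.comp_apply, perm_apply]
  have : ∫ u, {u | ∀ i, T < u i}.indicator g u =
      ∫ u : Fin n → ℝ, ∑ σ : Equiv.Perm (Fin n), (SS n T).indicator g (fun i => u (σ i)) := by
    refine integral_congr_ae ?_
    filter_upwards [ae_inj n] with u hu
    by_cases hb : ∀ i, T < u i
    · rw [Set.indicator_of_mem (show u ∈ {u : Fin n → ℝ | ∀ i, T < u i} from hb), sum_eq_single (Tuple.sort u)]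
      · rw [Set.indicator_of_mem, hg]
        exact ⟨fun i => hb _, (Tuple.monotone_sort u).strictMono_of_injective
          (hu.comp (Tuple.sort u).injective)⟩
      · intro σ _ hne
        refine Set.indicator_of_notMem (fun h => hne ?_) _
        have := Tuple.unique_monotone (f := u) (σ := σ) (τ := Tuple.sort u) h.2.monotone (Tuple.monotone_sort u)
        ext i
        exact congrArg Fin.val (hu (congrFun this i))
      · simp
    · rw [Set.indicator_of_notMem (show u ∉ {u : Fin n → ℝ | ∀ i, T < u i} from hb), sum_eq_zero]
      intro σ _
      refine Set.indicator_of_notMem (fun h => hb fun i => ?_) _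
      simpa using h.1 (σ.symm i)
  rw [this, integral_finsetSum _ fun σ _ => hσi σ]
  simp_rw [hσ]
  simp [Fintype.card_perm]

lemma integrable_of {n : ℕ} (κ : ℝ) (h : 2 * (n : ℝ) < κ) :
    IntegrableOn
        (fun u : Fin n → ℝ =>
          (∏ d : Fin n, u d ^ (-(κ / 2))) *
            ∏ q ∈ Finset.univ.filter (fun q : Fin n × Fin n => q.1 < q.2),
              |u q.1 - u q.2|)
        {u : Fin n → ℝ | ∀ i, 4 ≤ u i} volume := by
  have hpos : ∀ i, 0 < sk n κ i := by
    intro i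
    have : ((i : ℕ) : ℝ) + 1 ≤ n := by exact_mod_cast i.2
    simp only [sk]; linarith
  have h1 := (DD_integrable (sk n κ) hpos (T := 3) (by norm_num)).abs
  have h2 : IntegrableOn (fun u => |DD (sk n κ) u|) {u : Fin n → ℝ | ∀ i, 4 ≤ u i} :=
    IntegrableOn.mono_set h1 fun u hu i => by have := hu i; linarith
  refine h2.congr_fun (fun u hu => (f_eq κ u fun i => by have := hu i; linarith).symm) ?_
  have : {u : Fin n → ℝ | ∀ i, 4 ≤ u i} = Set.univ.pi fun _ => Set.Ici 4 := by ext; simp [-Set.pi_univ_Ici]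
  rw [this]
  exact MeasurableSet.univ_pi fun _ => measurableSet_Ici

lemma integral_val {n : ℕ} (κ : ℝ) (h : 2 * (n : ℝ) < κ) :
    ∫ u in {u : Fin n → ℝ | ∀ i, 4 ≤ u i},
              (∏ d : Fin n, u d ^ (-(κ / 2))) *
                ∏ q ∈ Finset.univ.filter (fun q : Fin n × Fin n => q.1 < q.2),
                  |u q.1 - u q.2| = n.factorial * ((4:ℝ) ^ (-∑ j, sk n κ j) * FF (sk n κ)) := by
  have hpos : ∀ i, 0 < sk n κ i := by
    intro i
    have : ((i : ℕ) : ℝ) + 1 ≤ n := by exact_mod_cast i.2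
    simp only [sk]; linarith
  have hinj : Function.Injective (sk n κ) := by
    intro i j hij
    simp only [sk] at hij
    have : ((i : ℕ) : ℝ) = (j : ℕ) := by linarith
    exact Fin.ext (by exact_mod_cast this)
  have hae : {u : Fin n → ℝ | ∀ i, 4 ≤ u i} =ᵐ[volume] {u : Fin n → ℝ | ∀ i, 4 < u i} := by
    have : {u : Fin n → ℝ | ∀ i, 4 ≤ u i} = Set.univ.pi fun _ => Set.Ici 4 := by ext; simp [-Set.pi_univ_Ici]
    rw [this, box_eq, volume_pi]
    exact (Measure.pi_Ioi_ae_eq_pi_Ici).symm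
  rw [setIntegral_congr_set hae, setIntegral_congr_fun (g := fun u => |DD (sk n κ) u|)
    (by rw [box_eq]; exact MeasurableSet.univ_pi fun _ => measurableSet_Ioi)
    (fun u hu => f_eq κ u fun i => by have := hu i; linarith),
    sym_int _ (fun u σ => absDD_perm _ u σ) 4 (DD_integrable' _ hpos (by norm_num)).abs,
    ← main_int n (sk n κ) hinj hpos 4 (by norm_num),
    setIntegral_congr_fun (measurableSet_SS n 4)]
  intro u hu
  exact abs_of_nonneg (DD_nonneg κ u (fun i => by have := hu.1 i; linarith) hu.2)

lemma converse {m : ℕ} (κ : ℝ) (h : IntegrableOn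
        (fun u : Fin (m+1) → ℝ =>
          (∏ d : Fin (m+1), u d ^ (-(κ / 2))) *
            ∏ q ∈ Finset.univ.filter (fun q : Fin (m+1) × Fin (m+1) => q.1 < q.2),
              |u q.1 - u q.2|)
        {u : Fin (m+1) → ℝ | ∀ i, 4 ≤ u i} volume) : 2 * ((m : ℝ) + 1) < κ := by
  have hmeas : MeasurableSet {u : Fin (m+1) → ℝ | ∀ i, 4 ≤ u i} := by
    have : {u : Fin (m+1) → ℝ | ∀ i, 4 ≤ u i} = Set.univ.pi fun _ => Set.Ici 4 := by ext; simp [-Set.pi_univ_Ici]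
    rw [this]
    exact MeasurableSet.univ_pi fun _ => measurableSet_Ici
  have h1 := (integrable_indicator_iff hmeas).2 h
  have h2 := ((mp_cons m).integrable_comp_emb (MeasurableEquiv.measurableEmbedding _)).2 h1
  have h3 := Integrable.prod_left_ae h2
  have hopen : IsOpen (Set.univ.pi fun _ : Fin m => Set.Ioi (4:ℝ)) :=
    isOpen_set_pi Set.finite_univ fun _ _ => isOpen_Ioi
  obtain ⟨y, ⟨hy, hyinj⟩, hy4⟩ := (Measure.dense_of_ae (h3.and (ae_inj m))).exists_mem_open hopen
    ⟨fun _ => 5, by simp; norm_num⟩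
  have hy4' : ∀ i, 4 < y i := fun i => hy4 i trivial
  set C : ℝ := (∏ i, y i ^ (-(κ / 2))) * |∏ i, ∏ j ∈ Ioi i, (y j - y i)| with hC
  have hCpos : 0 < C := by
    refine mul_pos (prod_pos fun i _ => Real.rpow_pos_of_pos (by have := hy4' i; linarith) _) ?_
    refine abs_pos.2 (prod_ne_zero_iff.2 fun i _ => prod_ne_zero_iff.2 fun j hj => ?_)
    exact sub_ne_zero.2 fun h => (mem_Ioi.1 hj).ne' (hyinj h)
  set M : ℝ := 4 + 2 * ∑ i, y i with hM
  have hyM : ∀ i, 2 * y i ≤ M := by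
    intro i
    have := single_le_sum (f := y) (fun j _ => by have := hy4' j; linarith) (mem_univ i)
    linarith
  have hM4 : 4 ≤ M := by
    have := sum_nonneg (s := univ) (f := y) (fun j _ => by have := hy4' j; linarith)
    linarith
  have hint : IntegrableOn (fun x : ℝ => x ^ (-(κ / 2) + m)) (Set.Ioi M) := by
    refine Integrable.mono' ((hy.const_mul (2 ^ m / C)).integrableOn (s := Set.Ioi M)) ?_ ?_
    · exact (measurable_id.pow_const _).aestronglyMeasurable
    · refine (ae_restrict_iff' measurableSet_Ioi).2 (Filter.Eventually.of_forall fun x hx => ?_)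
      have hxM : M < x := hx
      have hx0 : 0 < x := by linarith
      have hmem : (Fin.cons x y : Fin (m+1) → ℝ) ∈ {u : Fin (m+1) → ℝ | ∀ i, 4 ≤ u i} := by
        intro i
        refine Fin.cases ?_ (fun i => ?_) i
        · simp; linarith
        · simpa using (hy4' i).le
      simp only [Function.comp_apply, cons_apply]
      rw [Set.indicator_of_mem hmem, absprod, Fin.prod_univ_succ, Fin.prod_univ_succ, abs_mul,
        Real.norm_of_nonneg (Real.rpow_pos_of_pos hx0 _).le]
      simp only [Fin.prod_Ioi_zero, Fin.prod_Ioi_succ, Fin.cons_zero, Fin.cons_succ]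
      have e : 2 ^ m / C * (x ^ (-(κ / 2)) * (∏ i, y i ^ (-(κ / 2))) *
          (|∏ j, (y j - x)| * |∏ i, ∏ j ∈ Ioi i, (y j - y i)|)) =
          x ^ (-(κ / 2)) * (2 ^ m * |∏ j, (y j - x)|) := by
        have : 2 ^ m / C * (x ^ (-(κ / 2)) * (∏ i, y i ^ (-(κ / 2))) *
          (|∏ j, (y j - x)| * |∏ i, ∏ j ∈ Ioi i, (y j - y i)|)) =
          2 ^ m / C * (x ^ (-(κ / 2)) * |∏ j, (y j - x)| * C) := by rw [hC]; ring
        rw [this]; field_simp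
      rw [e, Real.rpow_add hx0, Real.rpow_natCast]
      refine mul_le_mul_of_nonneg_left ?_ (Real.rpow_pos_of_pos hx0 _).le
      have e2 : (2:ℝ) ^ m * |∏ j, (y j - x)| = ∏ j, (2 * |y j - x|) := by
        rw [prod_mul_distrib, abs_prod]; simp
      have e3 : x ^ m = ∏ _j : Fin m, x := by simp
      rw [e2, e3]
      refine prod_le_prod (fun _ _ => hx0.le) fun j _ => ?_
      have := hyM j
      rw [abs_sub_comm]
      have := le_abs_self (x - y j)
      linarith
  have := (integrableOn_Ioi_rpow_iff (by linarith)).1 hint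
  linarith

lemma FF_val (m : ℕ) (κ : ℝ) (h : 2 * ((m+1 : ℕ) : ℝ) < κ) :
    FF (sk (m+1) κ) * ∏ q ∈ Finset.univ.filter (fun q : Fin (m+1) × Fin (m+1) => q.1 ≤ q.2),
              (κ - (((q.1 : ℕ) + 1) + ((q.2 : ℕ) + 1))) = 2 ^ (m+1) * (m.superFactorial : ℝ) := by
  have hpos : ∀ i, 0 < sk (m+1) κ i := by
    intro i
    have : ((i : ℕ) : ℝ) + 1 ≤ ((m+1 : ℕ) : ℝ) := by exact_mod_cast i.2
    simp only [sk]; linarith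
  have hsum : ∀ i k : Fin (m+1), (κ - (((i : ℕ) + 1) + ((k : ℕ) + 1))) = sk (m+1) κ i + sk (m+1) κ k := by
    intro i k; simp only [sk]; ring
  rw [← Matrix.det_vandermonde_id_eq_superFactorial, Matrix.det_vandermonde, prod_filter,
    Fintype.prod_prod_type]
  simp only [hsum]
  have e1 : ∀ i k : Fin (m+1), (if i ≤ k then sk (m+1) κ i + sk (m+1) κ k else 1) =
      (if i < k then sk (m+1) κ i + sk (m+1) κ k else 1) * (if i = k then 2 * sk (m+1) κ i else 1) := by
    intro i k
    rcases lt_trichotomy i k with h | h | h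
    · simp [h, h.le, h.ne]
    · subst h; simp; ring
    · simp [h.not_gt, h.not_ge, h.ne']
  simp only [e1, prod_mul_distrib, prod_ite_eq, mem_univ, if_true]
  have e2 : ∀ i : Fin (m+1), ∏ j ∈ Ioi i, (((j : ℕ) : ℝ) - ((i : ℕ) : ℝ)) =
      ∏ k, if i < k then sk (m+1) κ i - sk (m+1) κ k else 1 := by
    intro i
    rw [← Finset.filter_lt_eq_Ioi, prod_filter]
    refine prod_congr rfl fun k _ => ?_
    simp only [sk]; congr 1; ring
  simp only [e2]
  have e3 : (∏ i, ∏ k, if i < k then sk (m+1) κ i - sk (m+1) κ k else 1) =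
    (∏ i, ∏ k, if i < k then (sk (m+1) κ i - sk (m+1) κ k) / (sk (m+1) κ i + sk (m+1) κ k) else 1) *
    (∏ i, ∏ k, if i < k then (sk (m+1) κ i + sk (m+1) κ k) else 1) := by
    rw [← prod_mul_distrib]
    refine prod_congr rfl fun i _ => ?_
    rw [← prod_mul_distrib]
    refine prod_congr rfl fun k _ => ?_
    have := hpos i
    have := hpos k
    split_ifs
    · field_simp
    · ring
  have e4 : (∏ j, (sk (m+1) κ j)⁻¹) * ∏ j, sk (m+1) κ j = 1 := by
    rw [← prod_mul_distrib]
    exact prod_eq_one fun j _ => inv_mul_cancel₀ (hpos j).ne'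
  rw [e3, FF]
  simp only [prod_const, card_univ, Fintype.card_fin]
  linear_combination (2 ^ (m+1) * (∏ i, ∏ k, if i < k then (sk (m+1) κ i - sk (m+1) κ k) / (sk (m+1) κ i + sk (m+1) κ k) else 1) *
    (∏ i, ∏ k, if i < k then (sk (m+1) κ i + sk (m+1) κ k) else 1)) * e4

lemma sum_sk (n : ℕ) (κ : ℝ) : ∑ j, sk n κ j = n * κ / 2 - n * (n + 1) / 2 := by
  unfold sk
  rw [Fin.sum_univ_eq_sum_range (fun j => κ / 2 - ((j : ℝ) + 1)) n]
  induction n with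
  | zero => simp
  | succ n ih => rw [sum_range_succ, ih]; push_cast; ring

lemma pow_val (n : ℕ) (κ : ℝ) :
    (2 : ℝ) ^ ((n : ℝ) * κ - n) * (4:ℝ) ^ (-∑ j, sk n κ j) * 2 ^ n = 2 ^ (n * (n + 1)) := by
  rw [sum_sk, show (4:ℝ) = 2 ^ (2:ℝ) by norm_num, ← Real.rpow_mul (by norm_num), ← Real.rpow_natCast,
    ← Real.rpow_natCast, ← Real.rpow_add (by norm_num), ← Real.rpow_add (by norm_num)]
  congr 1
  push_cast; ring

/-- Evaluation of the Cartan-decomposition integral for the `L^ℓ` norm of the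
holomorphic discrete series matrix coefficient of `Sp(2n,ℝ)`:
`u ↦ ∏ u_d^{−κ/2} ∏_{i<j}|uᵢ−uⱼ|` is integrable on `[4,∞)ⁿ` iff `κ > 2n`, and then
`2^{nκ−n} ∫ = 2^{n(n+1)} ∏_{j=1}^n j! / ∏_{1≤i≤j≤n} (κ−(i+j))`. -/
theorem stmt_7 (n : ℕ) (hn : 1 ≤ n) (κ : ℝ) :
    (IntegrableOn
        (fun u : Fin n → ℝ =>
          (∏ d : Fin n, u d ^ (-(κ / 2))) *
            ∏ q ∈ Finset.univ.filter (fun q : Fin n × Fin n => q.1 < q.2),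
              |u q.1 - u q.2|)
        {u : Fin n → ℝ | ∀ i, 4 ≤ u i} volume ↔ 2 * (n : ℝ) < κ) ∧
      (2 * (n : ℝ) < κ →
        (2 : ℝ) ^ ((n : ℝ) * κ - n) *
            ∫ u in {u : Fin n → ℝ | ∀ i, 4 ≤ u i},
              (∏ d : Fin n, u d ^ (-(κ / 2))) *
                ∏ q ∈ Finset.univ.filter (fun q : Fin n × Fin n => q.1 < q.2),
                  |u q.1 - u q.2| =
          2 ^ (n * (n + 1)) * (∏ j ∈ Finset.range n, ((Nat.factorial (j + 1) : ℕ) : ℝ)) /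
            ∏ q ∈ Finset.univ.filter (fun q : Fin n × Fin n => q.1 ≤ q.2),
              (κ - (((q.1 : ℕ) + 1) + ((q.2 : ℕ) + 1)))) := by
  obtain ⟨m, rfl⟩ : ∃ m, n = m + 1 := ⟨n - 1, by omega⟩
  refine ⟨⟨fun h => ?_, fun h => integrable_of κ h⟩, fun h => ?_⟩
  · have := converse κ h
    push_cast; exact this
  · rw [integral_val κ h]
    have hne : ∏ q ∈ Finset.univ.filter (fun q : Fin (m+1) × Fin (m+1) => q.1 ≤ q.2),
              (κ - (((q.1 : ℕ) + 1) + ((q.2 : ℕ) + 1))) ≠ 0 := by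
      refine prod_ne_zero_iff.2 fun q _ => ?_
      have h1 : ((q.1 : ℕ) : ℝ) + 1 ≤ ((m+1 : ℕ) : ℝ) := by exact_mod_cast q.1.2
      have h2 : ((q.2 : ℕ) : ℝ) + 1 ≤ ((m+1 : ℕ) : ℝ) := by exact_mod_cast q.2.2
      have : 0 < κ - ((((q.1 : ℕ) : ℝ) + 1) + (((q.2 : ℕ) : ℝ) + 1)) := by linarith
      exact this.ne'
    have hsf : (∏ j ∈ Finset.range (m+1), ((Nat.factorial (j + 1) : ℕ) : ℝ)) =
        ((m+1).factorial : ℝ) * (m.superFactorial : ℝ) := by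
      rw [← Nat.cast_prod, Nat.prod_range_factorial_succ, Nat.superFactorial_succ]
      push_cast; rfl
    rw [eq_div_iff hne, hsf, ← pow_val (m+1) κ]
    linear_combination ((2 : ℝ) ^ (((m+1 : ℕ) : ℝ) * κ - ((m+1 : ℕ) : ℝ)) *
      (4:ℝ) ^ (-∑ j, sk (m+1) κ j) * ((m+1).factorial : ℝ)) * FF_val m κ h
end

section
/- Let n ≥ 1 and let α, β ∈ M_n(ℂ) satisfy ᵀᾱ·α = Iₙ + ᵀβ·β̄, ᵀα·ᾱ = Iₙ + ᵀβ̄·β, and ᵀβ̄·α = ᵀα·β̄ (where ᾱ, β̄ denote entrywise complex conjugates). Then α is invertible and the 2n×2n block matrix [[α, β],[β̄, ᾱ]] factors as [[Iₙ, 0],[β̄·α⁻¹, Iₙ]] · [[α, 0],[0, ᵀα⁻¹]] · [[Iₙ, α⁻¹·β],[0, Iₙ]]; equivalently, ᾱ = ᵀα⁻¹ + β̄·α⁻¹·β. -/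
open Matrix
open scoped ComplexOrder

/-- Explicit Harish-Chandra decomposition of an element `[[α, β],[β̄, ᾱ]]` of the
group `G' = {g ∈ SU(n,n) : ᵀg·J·g = J}`: `α` is invertible and
`[[α,β],[β̄,ᾱ]] = [[1,0],[β̄α⁻¹,1]]·[[α,0],[0,ᵀα⁻¹]]·[[1,α⁻¹β],[0,1]]`;
equivalently `ᾱ = ᵀα⁻¹ + β̄α⁻¹β`. -/
theorem stmt_17 (n : ℕ) (hn : 1 ≤ n) (α β : Matrix (Fin n) (Fin n) ℂ)
    (h1 : (α.map (starRingEnd ℂ))ᵀ * α = 1 + βᵀ * β.map (starRingEnd ℂ))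
    (h2 : αᵀ * α.map (starRingEnd ℂ) = 1 + (β.map (starRingEnd ℂ))ᵀ * β)
    (h3 : (β.map (starRingEnd ℂ))ᵀ * α = αᵀ * β.map (starRingEnd ℂ)) :
    IsUnit α ∧
      Matrix.fromBlocks α β (β.map (starRingEnd ℂ)) (α.map (starRingEnd ℂ)) =
        Matrix.fromBlocks 1 0 (β.map (starRingEnd ℂ) * α⁻¹) 1 *
          Matrix.fromBlocks α 0 0 (αᵀ)⁻¹ *
          Matrix.fromBlocks 1 (α⁻¹ * β) 0 1 ∧
      α.map (starRingEnd ℂ) = (αᵀ)⁻¹ + β.map (starRingEnd ℂ) * α⁻¹ * β := by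
  have hb : βᵀ = (β.map (starRingEnd ℂ))ᴴ := by
    ext i j
    simp [Matrix.conjTranspose_apply]
  have hpd : (1 + βᵀ * β.map (starRingEnd ℂ)).PosDef := by
    rw [hb]
    exact Matrix.PosDef.one.add_posSemidef (Matrix.posSemidef_conjTranspose_mul_self _)
  have hu : IsUnit α := by
    have h := hpd.isUnit
    rw [← h1, Matrix.isUnit_iff_isUnit_det, Matrix.det_mul] at h
    rw [Matrix.isUnit_iff_isUnit_det]
    exact isUnit_of_mul_isUnit_right h
  have hd : IsUnit α.det := (Matrix.isUnit_iff_isUnit_det _).1 hu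
  have hdt : IsUnit αᵀ.det := by rwa [Matrix.det_transpose]
  have key : β.map (starRingEnd ℂ) * α⁻¹ = (αᵀ)⁻¹ * (β.map (starRingEnd ℂ))ᵀ := by
    calc β.map (starRingEnd ℂ) * α⁻¹
        = (αᵀ)⁻¹ * (αᵀ * β.map (starRingEnd ℂ)) * α⁻¹ := by
          rw [Matrix.nonsing_inv_mul_cancel_left _ _ hdt]
      _ = (αᵀ)⁻¹ * (β.map (starRingEnd ℂ))ᵀ := by
          rw [← h3, ← Matrix.mul_assoc, Matrix.mul_nonsing_inv_cancel_right _ _ hd]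
  have hfin : α.map (starRingEnd ℂ) = (αᵀ)⁻¹ + β.map (starRingEnd ℂ) * α⁻¹ * β := by
    calc α.map (starRingEnd ℂ) = (αᵀ)⁻¹ * (αᵀ * α.map (starRingEnd ℂ)) := by
          rw [Matrix.nonsing_inv_mul_cancel_left _ _ hdt]
      _ = _ := by
          rw [h2, key, Matrix.mul_add, Matrix.mul_one, Matrix.mul_assoc]
  refine ⟨hu, ?_, hfin⟩
  simp only [Matrix.fromBlocks_multiply, Matrix.one_mul, Matrix.mul_one, Matrix.zero_mul,
    Matrix.mul_zero, add_zero, zero_add]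
  rw [Matrix.nonsing_inv_mul_cancel_right _ _ hd, Matrix.mul_nonsing_inv_cancel_left _ _ hd,
    ← Matrix.mul_assoc, add_comm, ← hfin]
end
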